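/- arXiv:1908.07383 — 2 statements merged into one kernel-verified Lean document; each statement's English description precedes it below -/
import Mathlib

section
/- Let f be a transcendental self-map of ℂ* and let e ∈ {0,∞}^ℕ. If G ⊆ ℂ* is a domain (nonempty open connected set) that is bounded in ℂ* and satisfies G ∩ I_e(f) ≠ ∅, then ∂G ∩ I_e(f) ≠ ∅, where ∂G is the boundary of G in ℂ*. -/
open Complex Topology Filter Set Function OnePoint

noncomputable section

/-- The chordal (spherical) distance on the Riemann sphere, restricted to finite points. -/
def chordalDist (z w : ℂ) : ℝ :=
  ‖z - w‖ / Real.sqrt ((1 + ‖z‖ ^ 2) * (1 + ‖w‖ ^ 2))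

/-- A transcendental self-map of `ℂ* = ℂ \ {0}`: a holomorphic self-map of the punctured
plane with essential singularities at `0` and `∞`; equivalently, on `ℂ*` it has the form
`z ^ m * exp (g z + h z⁻¹)` for some `m : ℤ` and nonconstant entire functions `g, h`. -/
def IsTranscendentalSelfMapCStar (f : ℂ → ℂ) : Prop :=
  ∃ (m : ℤ) (g h : ℂ → ℂ),
    Differentiable ℂ g ∧ Differentiable ℂ h ∧
    (¬ ∃ c : ℂ, ∀ z, g z = c) ∧ (¬ ∃ c : ℂ, ∀ z, h z = c) ∧
    ∀ z : ℂ, z ≠ 0 → f z = z ^ m * Complex.exp (g z + h z⁻¹)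

/-- The escaping set `I(f)` of a self-map of the punctured plane: points whose orbit
accumulates only at `0` and `∞`. -/
def escapingSet (f : ℂ → ℂ) : Set ℂ :=
  {z | z ≠ 0 ∧ ∀ ε : ℝ, 0 < ε → ∃ N : ℕ, ∀ n ≥ N,
    ‖f^[n] z‖ < ε ∨ 1 / ε < ‖f^[n] z‖}

/-- The little escaping set `I_e(f)` with essential itinerary `e` (where `true` stands for the
symbol `∞` and `false` for the symbol `0`). -/
def littleEscapingSet (f : ℂ → ℂ) (e : ℕ → Bool) : Set ℂ :=
  {z | z ∈ escapingSet f ∧ ∃ ℓ k : ℕ, ∀ n : ℕ,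
    (1 < ‖f^[n + ℓ] z‖ ↔ e (n + k) = true)}

/-- The immediate little escaping set `Ĩ_e(f)`. -/
def immediateLittleEscapingSet (f : ℂ → ℂ) (e : ℕ → Bool) : Set ℂ :=
  {z | z ∈ escapingSet f ∧ ∃ ℓ : ℕ, ∀ n : ℕ,
    (1 < ‖f^[n + ℓ] z‖ ↔ e (n + ℓ) = true)}

/-- The Fatou set of a self-map of the punctured plane: points of `ℂ*` with a neighbourhood
(inside `ℂ*`) on which the family of iterates is equicontinuous w.r.t. the chordal metric. -/
def FatouSet (f : ℂ → ℂ) : Set ℂ :=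
  {z | z ≠ 0 ∧ ∃ U : Set ℂ, IsOpen U ∧ z ∈ U ∧ (∀ w ∈ U, w ≠ 0) ∧
    ∀ w ∈ U, ∀ ε : ℝ, 0 < ε → ∃ δ : ℝ, 0 < δ ∧ ∀ w' ∈ U,
      chordalDist w w' < δ → ∀ n : ℕ, chordalDist (f^[n] w) (f^[n] w') < ε}

/-- The Julia set `J(f) = ℂ* \ F(f)`. -/
def JuliaSet (f : ℂ → ℂ) : Set ℂ := {z : ℂ | z ≠ 0} \ FatouSet f

/-- A Fatou component: a connected component of the Fatou set. -/
def IsFatouComponent (f : ℂ → ℂ) (U : Set ℂ) : Prop :=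
  ∃ z ∈ FatouSet f, U = connectedComponentIn (FatouSet f) z

/-- A wandering domain: a Fatou component `U` such that the Fatou components containing the
iterated images `fⁿ(U)` are pairwise distinct. -/
def IsWanderingDomain (f : ℂ → ℂ) (U : Set ℂ) : Prop :=
  IsFatouComponent f U ∧ ∃ V : ℕ → Set ℂ, V 0 = U ∧
    (∀ n, IsFatouComponent f (V n)) ∧
    (∀ n, f '' V n ⊆ V (n + 1)) ∧ Function.Injective V

/-- A set is bounded in `ℂ*` if it lies in some closed annulus `{r ≤ |z| ≤ R}`. -/
def BoundedInCStar (X : Set ℂ) : Prop :=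
  ∃ r R : ℝ, 0 < r ∧ r ≤ R ∧ X ⊆ {z : ℂ | r ≤ ‖z‖ ∧ ‖z‖ ≤ R}

/-- The boundary of a subset of `ℂ*` taken in `ℂ*`. -/
def boundaryInCStar (G : Set ℂ) : Set ℂ := frontier G \ {0}

/-- The set `I(f) ∪ {0, ∞}` regarded as a subset of the Riemann sphere `ℂ̂ = ℂ ∪ {∞}`. -/
def escapingSphere (f : ℂ → ℂ) : Set (OnePoint ℂ) :=
  ((fun z : ℂ => (z : OnePoint ℂ)) '' escapingSet f) ∪ {((0 : ℂ) : OnePoint ℂ), ∞}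

/-- The set `I_e(f) ∪ {0, ∞}` regarded as a subset of the Riemann sphere. -/
def littleEscapingSphere (f : ℂ → ℂ) (e : ℕ → Bool) : Set (OnePoint ℂ) :=
  ((fun z : ℂ => (z : OnePoint ℂ)) '' littleEscapingSet f e) ∪ {((0 : ℂ) : OnePoint ℂ), ∞}

/-- A subset of the sphere has exactly two connected components. -/
def HasExactlyTwoComponents (K : Set (OnePoint ℂ)) : Prop :=
  ∃ x ∈ K, ∃ y ∈ K, connectedComponentIn K x ≠ connectedComponentIn K y ∧
    ∀ z ∈ K, connectedComponentIn K z = connectedComponentIn K x ∨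
      connectedComponentIn K z = connectedComponentIn K y

/-- A domain `U ⊆ ℂ*` is doubly connected if its complement in the Riemann sphere has
exactly two connected components. -/
def DoublyConnected (U : Set ℂ) : Prop :=
  HasExactlyTwoComponents (((fun z : ℂ => (z : OnePoint ℂ)) '' U)ᶜ)

/-- A transcendental entire function. -/
def IsTranscendentalEntire (f : ℂ → ℂ) : Prop :=
  Differentiable ℂ f ∧ ¬ ∃ p : Polynomial ℂ, ∀ z, f z = p.eval z

/-- The Fatou set of an entire function. -/
def FatouSetEntire (f : ℂ → ℂ) : Set ℂ :=
  {z | ∃ U : Set ℂ, IsOpen U ∧ z ∈ U ∧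
    ∀ w ∈ U, ∀ ε : ℝ, 0 < ε → ∃ δ : ℝ, 0 < δ ∧ ∀ w' ∈ U,
      chordalDist w w' < δ → ∀ n : ℕ, chordalDist (f^[n] w) (f^[n] w') < ε}

/-- The Julia set of an entire function. -/
def JuliaSetEntire (f : ℂ → ℂ) : Set ℂ := (FatouSetEntire f)ᶜ

/-- `f` has a finite asymptotic value. -/
def HasFiniteAsymptoticValue (f : ℂ → ℂ) : Prop :=
  ∃ (a : ℂ) (γ : ℝ → ℂ), ContinuousOn γ (Set.Ici (0 : ℝ)) ∧
    Tendsto (fun t => ‖γ t‖) atTop atTop ∧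
    Tendsto (fun t => f (γ t)) atTop (nhds a)

open Metric in
lemma ball_subset_image_of_norm_deriv_le {q : ℂ → ℂ} {c : ℂ} {δ : ℝ} (hδ : 0 < δ)
    (hq : DifferentiableOn ℂ q (ball c δ)) (hd : deriv q c ≠ 0)
    (hb : ∀ z ∈ ball c δ, ‖deriv q z‖ ≤ 2 * ‖deriv q c‖) :
    ball (q c) (δ * ‖deriv q c‖ / 24) ⊆ q '' ball c δ := by
  set K := ‖deriv q c‖ with hK
  have hKpos : 0 < K := norm_pos_iff.mpr hd
  have hsub : closedBall c (δ / 6) ⊆ ball c δ := closedBall_subset_ball (by linarith)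
  have hqd : ∀ z ∈ ball c δ, DifferentiableAt ℂ q z := fun z hz =>
    hq.differentiableAt (isOpen_ball.mem_nhds hz)
  have hD : DifferentiableOn ℂ (deriv q) (ball c δ) := hq.deriv isOpen_ball
  have hDlip : ∀ z ∈ ball c δ, ‖deriv q z - deriv q c‖ ≤ 3 * K / δ * ‖z - c‖ := by
    intro z hz
    have := dist_le_div_mul_dist_of_mapsTo_ball (R₂ := 3 * K) hD (fun w hw => by
      rw [mem_closedBall, dist_eq_norm]
      calc _ ≤ ‖deriv q w‖ + ‖deriv q c‖ := norm_sub_le _ _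
        _ ≤ 3 * K := by have := hb w hw; linarith) hz
    simpa [dist_eq_norm] using this
  have hlow : ∀ z ∈ sphere c (δ / 6), δ * K / 12 ≤ ‖q z - q c‖ := by
    intro z hz
    have hz' : ‖z - c‖ = δ / 6 := by simpa [dist_eq_norm] using hz
    have h1 : ‖(q z - deriv q c * z) - (q c - deriv q c * c)‖ ≤ K / 2 * ‖z - c‖ := by
      refine (convex_closedBall c (δ / 6)).norm_image_sub_le_of_norm_deriv_le
        (f := fun z => q z - deriv q c * z) (fun w hw => ?_) (fun w hw => ?_)
        (mem_closedBall_self (by linarith)) (sphere_subset_closedBall hz)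
      · exact (hqd w (hsub hw)).sub (by fun_prop)
      · rw [deriv_fun_sub (hqd w (hsub hw)) (by fun_prop)]
        simp only [deriv_const_mul_id']
        refine (hDlip w (hsub hw)).trans ?_
        have : ‖w - c‖ ≤ δ / 6 := by simpa [dist_eq_norm] using hw
        calc 3 * K / δ * ‖w - c‖ ≤ 3 * K / δ * (δ / 6) := by gcongr
          _ = K / 2 := by field_simp; norm_num
    have h2 : ‖deriv q c * (z - c)‖ ≤ ‖q z - q c‖ + K / 2 * ‖z - c‖ := by
      calc _ = ‖(q z - q c) - ((q z - deriv q c * z) - (q c - deriv q c * c))‖ := by ring_nf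
        _ ≤ _ := (norm_sub_le _ _).trans (by gcongr)
    rw [norm_mul, hz'] at h2
    linarith
  have hfreq : ∃ᶠ z in 𝓝 c, q z ≠ q c := by
    intro h
    apply hd
    have : q =ᶠ[𝓝 c] fun _ => q c := by
      filter_upwards [h] with z hz
      simpa using hz
    rw [this.deriv_eq]; simp
  have hcl : DiffContOnCl ℂ q (ball c (δ / 6)) := by
    apply DifferentiableOn.diffContOnCl
    rw [closure_ball _ (by positivity)]
    exact hq.mono hsub
  have := hcl.ball_subset_image_closedBall (by positivity) hlow hfreq
  refine (Metric.ball_subset_ball (by linarith)).trans (this.trans (image_mono hsub))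

open Metric in
/-- A weak form of **Bloch's theorem**. -/
lemma norm_deriv_mul_le_of_not_ball_subset_image {q : ℂ → ℂ} {c : ℂ} {ρ B : ℝ}
    (hB : 0 < B) (hq : DifferentiableOn ℂ q (ball c ρ))
    (hno : ∀ w, ¬ ball w B ⊆ q '' ball c ρ) : ‖deriv q c‖ * ρ ≤ 48 * B := by
  by_contra! hcon
  have hpos : 0 < ‖deriv q c‖ := by
    by_contra! h
    have : ‖deriv q c‖ = 0 := le_antisymm h (norm_nonneg _)
    rw [this] at hcon; linarith
  obtain ⟨R, hR1, hR2⟩ : ∃ R, 48 * B / ‖deriv q c‖ < R ∧ R < ρ :=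
    exists_between (by rwa [div_lt_iff₀ hpos, mul_comm ρ])
  have hR0 : 0 < R := lt_trans (by positivity) hR1
  have hsub : closedBall c R ⊆ ball c ρ := closedBall_subset_ball hR2
  have hcont : ContinuousOn (fun z => ‖deriv q z‖ * (R - ‖z - c‖)) (closedBall c R) := by
    refine ContinuousOn.mul ((hq.deriv isOpen_ball).continuousOn.mono hsub).norm ?_
    fun_prop
  obtain ⟨x, hx, hmax⟩ := (isCompact_closedBall c R).exists_isMaxOn
    ⟨c, mem_closedBall_self hR0.le⟩ hcont
  have hmax' : ∀ z ∈ closedBall c R, ‖deriv q z‖ * (R - ‖z - c‖) ≤ ‖deriv q x‖ * (R - ‖x - c‖) :=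
    fun z hz => hmax hz
  have hM : 48 * B < ‖deriv q x‖ * (R - ‖x - c‖) := by
    have := hmax' c (mem_closedBall_self hR0.le)
    rw [div_lt_iff₀ hpos] at hR1
    simp only [sub_self, norm_zero, sub_zero] at this
    linarith
  have hxc : ‖x - c‖ ≤ R := by simpa [dist_eq_norm] using hx
  have hne : 0 < ‖deriv q x‖ := by
    by_contra! h
    have : ‖deriv q x‖ = 0 := le_antisymm h (norm_nonneg _)
    rw [this] at hM; linarith
  have hlt : 0 < R - ‖x - c‖ := by
    by_contra! h
    nlinarith
  set δ := (R - ‖x - c‖) / 2 with hδ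
  have hball : ∀ z ∈ ball x δ, z ∈ closedBall c R ∧ δ ≤ R - ‖z - c‖ := by
    intro z hz
    have h1 : ‖z - x‖ < δ := by simpa [dist_eq_norm] using hz
    have h2 : ‖z - c‖ ≤ ‖z - x‖ + ‖x - c‖ := norm_sub_le_norm_sub_add_norm_sub z x c
    constructor
    · rw [mem_closedBall, dist_eq_norm]; linarith
    · linarith
  have hsub2 : ball x δ ⊆ ball c ρ := fun z hz => hsub (hball z hz).1
  have key := ball_subset_image_of_norm_deriv_le (q := q) (c := x) (δ := δ) (by positivity)
    (hq.mono hsub2) (norm_pos_iff.mp hne) (fun z hz => by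
      have h1 := hmax' z (hball z hz).1
      have h2 := (hball z hz).2
      have h3 : ‖deriv q z‖ * δ ≤ ‖deriv q x‖ * (2 * δ) := by
        calc _ ≤ ‖deriv q z‖ * (R - ‖z - c‖) := by gcongr
          _ ≤ _ := h1
          _ = _ := by rw [hδ]; ring
      have hδ0 : 0 < δ := by positivity
      nlinarith)
  refine hno (q x) ((Metric.ball_subset_ball ?_).trans (key.trans (image_mono hsub2)))
  rw [le_div_iff₀ (by norm_num), hδ]
  linarith

open Metric in
lemma exists_exp_eq_on_ball {g : ℂ → ℂ} {c : ℂ} {ρ : ℝ} (hρ : 0 < ρ)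
    (hg : DifferentiableOn ℂ g (ball c ρ)) (h0 : ∀ z ∈ ball c ρ, g z ≠ 0) :
    ∃ L : ℂ → ℂ, DifferentiableOn ℂ L (ball c ρ) ∧ ∀ z ∈ ball c ρ, exp (L z) = g z := by
  have hlog : DifferentiableOn ℂ (fun z => deriv g z / g z) (ball c ρ) :=
    (hg.deriv isOpen_ball).div hg h0
  obtain ⟨L₀, hL₀⟩ := hlog.isExactOn_ball
  set L : ℂ → ℂ := fun z => L₀ z - L₀ c + log (g c) with hLdef
  have hL : ∀ z ∈ ball c ρ, HasDerivAt L (deriv g z / g z) z := fun z hz =>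
    ((hL₀ z hz).sub_const _).add_const _
  refine ⟨L, fun z hz => (hL z hz).differentiableAt.differentiableWithinAt, ?_⟩
  have hgd : ∀ z ∈ ball c ρ, HasDerivAt g (deriv g z) z := fun z hz =>
    (hg.differentiableAt (isOpen_ball.mem_nhds hz)).hasDerivAt
  have hder : ∀ z ∈ ball c ρ, HasDerivAt (fun z => g z * exp (-L z)) 0 z := by
    intro z hz
    have := (hgd z hz).mul (hL z hz).neg.cexp
    refine this.congr_deriv ?_
    have := h0 z hz
    simp only [Pi.neg_apply]
    field_simp
    ring
  have hc : c ∈ ball c ρ := mem_ball_self hρ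
  intro z hz
  have hconst := (convex_ball c ρ).is_const_of_fderivWithin_eq_zero (𝕜 := ℂ)
    (f := fun z => g z * exp (-L z))
    (fun w hw => (hder w hw).differentiableAt.differentiableWithinAt) (fun w hw => by
      rw [fderivWithin_of_isOpen isOpen_ball hw]
      ext
      simp [(hder w hw).deriv]) hz hc
  have hLc : exp (-L c) = (g c)⁻¹ := by
    simp [hLdef, Complex.exp_neg, Complex.exp_log (h0 c hc)]
  simp only [hLc, mul_inv_cancel₀ (h0 c hc), Complex.exp_neg] at hconst
  field_simp [Complex.exp_ne_zero] at hconst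
  exact hconst.symm

open Metric in
lemma exists_norm_le_of_omits_int : ∃ C : ℝ, ∀ (P : ℂ → ℂ) (p : ℂ) (ρ : ℝ), 0 < ρ →
    DifferentiableOn ℂ P (ball p ρ) → (∀ z ∈ ball p ρ, ∀ m : ℤ, P z ≠ m) →
    (P p).im = 0 → |(P p).re| < 1 → ∀ z ∈ ball p (ρ / 2), ‖P z‖ ≤ C := by
  refine ⟨Real.exp 864, fun P p ρ hρ hP hInt0 him hre => ?_⟩
  have hp : p ∈ ball p ρ := mem_ball_self hρ
  have hP1 : ∀ z ∈ ball p ρ, P z ^ 2 - 1 ≠ 0 := by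
    intro z hz h
    have h' : (P z - 1) * (P z + 1) = 0 := by linear_combination h
    rcases mul_eq_zero.mp h' with h | h
    · exact hInt0 z hz 1 (by push_cast; linear_combination h)
    · exact hInt0 z hz (-1) (by push_cast; linear_combination h)
  obtain ⟨L₁, hL₁d, hL₁⟩ := exists_exp_eq_on_ball hρ ((hP.pow 2).sub_const 1) hP1
  set S : ℂ → ℂ := fun z => exp (L₁ z / 2) with hS
  have hSd : DifferentiableOn ℂ S (ball p ρ) := (hL₁d.div_const 2).cexp
  have hS2 : ∀ z ∈ ball p ρ, S z ^ 2 = P z ^ 2 - 1 := by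
    intro z hz
    have h1 := hL₁ z hz
    simp only [Pi.pow_apply] at h1
    rw [← h1, hS, ← Complex.exp_nat_mul]
    congr 1; push_cast; ring
  have hprod : ∀ z ∈ ball p ρ, (P z + S z) * (P z - S z) = 1 := by
    intro z hz
    linear_combination -(hS2 z hz)
  obtain ⟨L, hLd, hL⟩ := exists_exp_eq_on_ball hρ (hP.add hSd)
    (fun z hz h => by
      have := hprod z hz
      simp only [Pi.add_apply] at h
      rw [h] at this; simp at this)
  have hL' : ∀ z ∈ ball p ρ, exp (-L z) = P z - S z := by
    intro z hz
    have h1 := hL z hz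
    simp only [Pi.add_apply] at h1
    rw [Complex.exp_neg, h1]
    exact inv_eq_of_mul_eq_one_right (hprod z hz)
  have hcosh : ∀ z ∈ ball p ρ, cosh (L z) = P z := by
    intro z hz
    have h1 := hL z hz
    simp only [Pi.add_apply] at h1
    rw [Complex.cosh, hL' z hz, h1]; ring
  have hLp : (L p).re = 0 := by
    have h2 := hS2 p hp
    have e1 := congrArg Complex.re h2
    have e2 := congrArg Complex.im h2
    simp only [pow_two, Complex.mul_re, Complex.mul_im, Complex.sub_re, Complex.sub_im,
      Complex.one_re, Complex.one_im, him] at e1 e2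
    have hlt : (P p).re * (P p).re < 1 := by
      have := abs_lt.mp hre; nlinarith
    have hSre : (S p).re = 0 := by
      have : (S p).re * (S p).im = 0 := by linarith
      rcases mul_eq_zero.mp this with h | h
      · exact h
      · rw [h] at e1; nlinarith [mul_self_nonneg (S p).re]
    have hn : ‖exp (L p)‖ = 1 := by
      have h1 := hL p hp
      simp only [Pi.add_apply] at h1
      rw [h1, ← sq_eq_sq₀ (norm_nonneg _) zero_le_one, ← Complex.normSq_eq_norm_sq,
        Complex.normSq_apply]
      simp only [Complex.add_re, Complex.add_im, him, hSre] at e1 ⊢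
      linarith
    rw [Complex.norm_exp] at hn
    exact Real.exp_eq_one_iff _ |>.mp hn
  have homit : ∀ w, ¬ ball w 9 ⊆ L '' ball p ρ := by
    intro w hw
    set x := |w.re| with hx
    have hx0 : 0 ≤ x := abs_nonneg _
    obtain ⟨y, hy, hym⟩ : ∃ y ∈ Icc x (x + 2), Real.cosh y = (⌈Real.cosh x⌉ : ℤ) := by
      apply intermediate_value_Icc (by linarith) Real.continuous_cosh.continuousOn
      refine ⟨Int.le_ceil _, (Int.ceil_lt_add_one _).le.trans ?_⟩
      rw [Real.cosh_add]
      have h1 : 1 ≤ Real.cosh x := Real.one_le_cosh x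
      have h2 : 0 ≤ Real.sinh x := Real.sinh_nonneg_iff.mpr hx0
      have h3 : 0 ≤ Real.sinh 2 := Real.sinh_nonneg_iff.mpr (by norm_num)
      have h4 : 2 ≤ Real.cosh 2 := by
        rw [Real.cosh_eq]
        have := Real.add_one_le_exp (1 : ℝ)
        have h5 : Real.exp 2 = Real.exp 1 * Real.exp 1 := by rw [← Real.exp_add]; norm_num
        have := Real.exp_pos (-2)
        nlinarith
      nlinarith [mul_nonneg h2 h3]
    set k := ⌊w.im / (2 * Real.pi)⌋ with hk
    have hπ := Real.pi_pos
    have hk1 : (k : ℝ) * (2 * Real.pi) ≤ w.im := by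
      rw [← le_div_iff₀ (by positivity)]; exact Int.floor_le _
    have hk2 : w.im < (k + 1 : ℝ) * (2 * Real.pi) := by
      rw [← div_lt_iff₀ (by positivity)]; exact Int.lt_floor_add_one _
    obtain ⟨σ, hσ, hσw⟩ : ∃ σ : ℝ, (σ = 1 ∨ σ = -1) ∧ w.re = σ * x := by
      rcases abs_choice w.re with h | h
      · exact ⟨1, Or.inl rfl, by rw [hx, h]; ring⟩
      · exact ⟨-1, Or.inr rfl, by rw [hx, h]; ring⟩
    set u : ℂ := ((σ * y : ℝ) : ℂ) + k * (2 * Real.pi * I) with hu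
    have hure : u.re = σ * y := by simp [hu]
    have huim : u.im = k * (2 * Real.pi) := by simp [hu]
    have hub : u ∈ ball w 9 := by
      rw [mem_ball, dist_eq_norm]
      have h1 : |(u - w).re| ≤ 2 := by
        rw [Complex.sub_re, hure, hσw, ← mul_sub, abs_mul]
        have : |σ| = 1 := by rcases hσ with h | h <;> simp [h]
        rw [this, one_mul, abs_of_nonneg (by linarith [hy.1])]
        linarith [hy.2]
      have h2 : |(u - w).im| < 6.4 := by
        rw [Complex.sub_im, huim, abs_lt]
        have := Real.pi_lt_d2
        constructor <;> linarith
      have := Complex.norm_le_abs_re_add_abs_im (u - w)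
      linarith
    obtain ⟨z, hz, hzu⟩ := hw hub
    refine hInt0 z hz ⌈Real.cosh x⌉ ?_
    rw [← hcosh z hz, hzu, hu]
    have : cosh (((σ * y : ℝ) : ℂ) + k * (2 * Real.pi * I)) = cosh ((σ * y : ℝ) : ℂ) := by
      rw [Complex.cosh, Complex.cosh, neg_add, Complex.exp_add, Complex.exp_add,
        Complex.exp_int_mul_two_pi_mul_I, Complex.exp_neg (_ * _),
        Complex.exp_int_mul_two_pi_mul_I]
      simp
    rw [this, ← Complex.ofReal_cosh]
    have h3 : Real.cosh (σ * y) = Real.cosh y := by rcases hσ with h | h <;> simp [h]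
    rw [h3, hym]; simp
  have hsub : ∀ z ∈ ball p (ρ / 2), ball z (ρ / 2) ⊆ ball p ρ := by
    intro z hz
    refine ball_subset_ball' ?_
    have := mem_ball.mp hz
    linarith
  have hder : ∀ z ∈ ball p (ρ / 2), ‖deriv L z‖ ≤ 864 / ρ := by
    intro z hz
    have := norm_deriv_mul_le_of_not_ball_subset_image (q := L) (c := z) (ρ := ρ / 2) (B := 9)
      (by norm_num) (hLd.mono (hsub z hz))
      (fun w hw => homit w (hw.trans (image_mono (hsub z hz))))
    rw [le_div_iff₀ hρ]; linarith
  intro z hz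
  have hsub' : ball p (ρ / 2) ⊆ ball p ρ := ball_subset_ball (by linarith)
  have hmv := (convex_ball p (ρ / 2)).norm_image_sub_le_of_norm_deriv_le (f := L)
    (fun w hw => hLd.differentiableAt (isOpen_ball.mem_nhds (hsub' hw))) hder
    (mem_ball_self (by positivity)) hz
  have hLz : |(L z).re| ≤ 864 := by
    have h1 : |(L z - L p).re| ≤ ‖L z - L p‖ := Complex.abs_re_le_norm _
    rw [Complex.sub_re, hLp, sub_zero] at h1
    have h2 : ‖z - p‖ ≤ ρ := by
      have := mem_ball.mp hz
      rw [dist_eq_norm] at this; linarith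
    calc _ ≤ _ := h1
      _ ≤ _ := hmv
      _ ≤ 864 / ρ * ρ := by gcongr
      _ = 864 := by field_simp
  rw [← hcosh z (hsub' hz), Complex.cosh]
  have h1 : ‖exp (L z)‖ ≤ Real.exp 864 := by
    rw [Complex.norm_exp]; exact Real.exp_le_exp.mpr (abs_le.mp hLz).2
  have h2 : ‖exp (-L z)‖ ≤ Real.exp 864 := by
    rw [Complex.norm_exp, Complex.neg_re]
    exact Real.exp_le_exp.mpr (by linarith [(abs_le.mp hLz).1])
  rw [norm_div]
  have := norm_add_le (exp (L z)) (exp (-L z))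
  simp only [Complex.norm_ofNat]
  linarith

open Metric in
/-- **Schottky's theorem**, normalised by `‖F p‖ = 1`. -/
lemma exists_abs_log_norm_le_of_omits : ∃ C : ℝ, ∀ (F : ℂ → ℂ) (p : ℂ) (ρ : ℝ), 0 < ρ →
    DifferentiableOn ℂ F (ball p ρ) → (∀ z ∈ ball p ρ, F z ≠ 0 ∧ F z ≠ 1) → ‖F p‖ = 1 →
    ∀ z ∈ ball p (ρ / 2), |Real.log ‖F z‖| ≤ C := by
  obtain ⟨C, hC⟩ := exists_norm_le_of_omits_int
  refine ⟨2 * Real.pi * C, fun F p ρ hρ hF hom hFp z hz => ?_⟩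
  obtain ⟨L, hLd, hL⟩ := exists_exp_eq_on_ball hρ hF (fun z hz => (hom z hz).1)
  have hp : p ∈ ball p ρ := mem_ball_self hρ
  have hlog : ∀ z ∈ ball p ρ, Real.log ‖F z‖ = (L z).re := by
    intro z hz
    rw [← hL z hz, Complex.norm_exp, Real.log_exp]
  have hπ : (2 * Real.pi * I : ℂ) ≠ 0 := Complex.two_pi_I_ne_zero
  set n := ⌊(L p / (2 * Real.pi * I)).re⌋ with hn
  have h := hC (fun z => L z / (2 * Real.pi * I) - n) p ρ hρ ((hLd.div_const _).sub_const _)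
    (fun z hz m hm => (hom z hz).2 <| by
      rw [← hL z hz, Complex.exp_eq_one_iff]
      refine ⟨m + n, ?_⟩
      rw [sub_eq_iff_eq_add, div_eq_iff hπ] at hm
      rw [hm]; push_cast; ring)
  have him : ∀ w : ℂ, (w / (2 * Real.pi * I)).im = - w.re / (2 * Real.pi) := by
    intro w
    rw [← div_div, Complex.div_I]
    have : (w / (2 * Real.pi) : ℂ) = w / ((2 * Real.pi : ℝ) : ℂ) := by push_cast; rfl
    rw [this]
    rw [Complex.neg_im, Complex.mul_I_im, Complex.div_ofReal_re, neg_div]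
  have hLp : (L p).re = 0 := by rw [← hlog p hp, hFp, Real.log_one]
  have hPz := h (by simp [him, hLp]) (by
    simp only [Complex.sub_re, Complex.intCast_re]
    rw [abs_lt, hn]
    exact ⟨by linarith [Int.floor_le (L p / (2 * Real.pi * I)).re],
      by linarith [Int.lt_floor_add_one (L p / (2 * Real.pi * I)).re]⟩) z hz
  have hzρ : z ∈ ball p ρ := ball_subset_ball (by linarith) hz
  rw [hlog z hzρ]
  have h3 := (Complex.abs_im_le_norm _).trans hPz
  rw [Complex.sub_im, him, Complex.intCast_im, sub_zero, abs_div, abs_neg,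
    abs_of_pos Real.two_pi_pos, div_le_iff₀ Real.two_pi_pos] at h3
  linarith

lemma exists_norm_eq_forall_re_le {k : ℂ → ℂ} (hk : Differentiable ℂ k) {R : ℝ} (hR : 0 < R) :
    ∃ z : ℂ, ‖z‖ = R ∧ ∀ w : ℂ, ‖w‖ ≤ R → (k w).re ≤ (k z).re := by
  obtain ⟨z, hz, hmax⟩ := Complex.exists_mem_frontier_isMaxOn_norm (f := fun z => exp (k z))
    (U := Metric.ball (0 : ℂ) R) Metric.isBounded_ball ⟨0, by simpa using hR⟩
    (hk.cexp.diffContOnCl)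
  rw [frontier_ball _ hR.ne'] at hz
  rw [closure_ball _ hR.ne'] at hmax
  refine ⟨z, by simpa using hz, fun w hw => ?_⟩
  have := hmax (show w ∈ Metric.closedBall (0 : ℂ) R by simpa using hw)
  simpa [Complex.norm_exp] using this

/-- Growth of the maximal real part `B r` of an entire function on the circle of radius
`exp r`: it grows faster than linearly, and at least doubles on steps of length `16`. -/
lemma exists_maxRe_growth {k : ℂ → ℂ} (hk : Differentiable ℂ k) (h0 : k 0 = 0)
    (hne : ∃ z, k z ≠ 0) :
    ∃ B : ℝ → ℝ, (∀ r z, ‖z‖ ≤ Real.exp r → (k z).re ≤ B r) ∧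
      (∀ r, ∃ z, ‖z‖ = Real.exp r ∧ (k z).re = B r) ∧
      (∀ K : ℝ, ∀ᶠ r in atTop, K * r + K ≤ B r) ∧
      (∀ᶠ r in atTop, B r ≤ B (r + 16) / 2) := by
  choose z hz hmax using fun r : ℝ => exists_norm_eq_forall_re_le hk (Real.exp_pos r)
  have hB0 : ∀ r, 0 ≤ (k (z r)).re := fun r => by
    simpa [h0] using hmax r 0 (by simpa using (Real.exp_pos r).le)
  have hBC : ∀ (r M : ℝ) (w : ℂ), 0 < M → (k (z r)).re ≤ M → ‖w‖ < Real.exp r →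
      ‖k w‖ ≤ 2 * M * ‖w‖ / (Real.exp r - ‖w‖) := fun r M w hM hrM hw =>
    Complex.borelCaratheodory_zero hM hk.differentiableOn
      (fun u hu => (hmax r u (by simpa using (mem_ball_zero_iff.1 hu).le)).trans hrM)
      (Real.exp_pos r) (by simpa using hw) h0
  have hlin : ∀ K : ℝ, ∀ᶠ r in atTop, K * r + K ≤ (k (z r)).re := by
    intro K
    obtain ⟨a, ha⟩ := hne
    have ha0 : 0 < ‖a‖ := by
      rw [norm_pos_iff]; rintro rfl; exact ha h0
    have hka : 0 < ‖k a‖ := norm_pos_iff.2 ha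
    set c := ‖k a‖ / (2 * ‖a‖) with hc
    have hcpos : 0 < c := by positivity
    have h1 : Tendsto (fun r : ℝ => (c * Real.exp r + 0) / r ^ 1) atTop atTop :=
      Real.tendsto_mul_exp_add_div_pow_atTop c 0 1 hcpos
    filter_upwards [h1.eventually_ge_atTop (|K| + |K| + 1 + c * ‖a‖), eventually_ge_atTop 1,
      Real.tendsto_exp_atTop.eventually_gt_atTop ‖a‖] with r hr hr1 hra
    have h2 := hBC r ((k (z r)).re + 1) a (by linarith [hB0 r]) (by linarith) hra
    rw [le_div_iff₀ (by linarith)] at h2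
    have h3 : c * (Real.exp r - ‖a‖) ≤ (k (z r)).re + 1 := by
      rw [hc, div_mul_eq_mul_div, div_le_iff₀ (by positivity)]
      linarith
    rw [le_div_iff₀ (by positivity)] at hr
    have hK := le_abs_self K
    have hK0 := abs_nonneg K
    have hca : 0 ≤ c * ‖a‖ := by positivity
    nlinarith [mul_nonneg hca (sub_nonneg.2 hr1), mul_nonneg hK0 (sub_nonneg.2 hr1),
      mul_nonneg (sub_nonneg.2 hK) (by linarith : (0:ℝ) ≤ r)]
  refine ⟨fun r => (k (z r)).re, fun r w hw => hmax r w hw, fun r => ⟨z r, hz r, rfl⟩, hlin, ?_⟩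
  filter_upwards [(tendsto_atTop_add_const_right atTop (16:ℝ) tendsto_id).eventually (hlin 1),
    eventually_ge_atTop 0] with r hr hr0
  simp only [id] at hr
  have hM : 0 < (k (z (r + 16))).re := by linarith
  have h16 : (17:ℝ) ≤ Real.exp 16 := by linarith [Real.add_one_le_exp (16:ℝ)]
  have hlt : ‖z r‖ < Real.exp (r + 16) := by rw [hz]; exact Real.exp_lt_exp.2 (by linarith)
  have := hBC (r + 16) _ (z r) hM le_rfl hlt
  have hre := (Complex.re_le_norm (k (z r))).trans this
  refine hre.trans ?_
  rw [div_le_iff₀ (by linarith), hz, Real.exp_add]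
  have he := Real.exp_pos r
  nlinarith [mul_pos hM he, mul_le_mul_of_nonneg_left h16 (mul_pos hM he).le]

/-- On the segment between two points, a continuous real function takes intermediate values. -/
lemma exists_mem_segment_eq {u : ℂ → ℝ} {x y : ℂ} (hu : ContinuousOn u (segment ℝ x y)) {t : ℝ}
    (hx : u x ≤ t) (hy : t ≤ u y) : ∃ p ∈ segment ℝ x y, u p = t :=
  (convex_segment x y).isPreconnected.intermediate_value (left_mem_segment ℝ x y)
    (right_mem_segment ℝ x y) hu ⟨hx, hy⟩

/-- A map `z ^ m * exp (g z + h z⁻¹)` with `g` nonconstant maps thick annuli near infinity over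
annuli that are as thick and further out. -/
lemma exists_annulus_covering {f g h : ℂ → ℂ} {m : ℤ} (hg : Differentiable ℂ g)
    (hh : Differentiable ℂ h) (hgc : ¬ ∃ c, ∀ z, g z = c)
    (hf : ∀ z : ℂ, z ≠ 0 → f z = z ^ m * exp (g z + h z⁻¹)) :
    ∃ r₀ : ℝ, ∀ r ≥ r₀, ∃ r' ≥ r + 1, (∀ z, z ≠ 0 → Real.log ‖z‖ = r → Real.log ‖f z‖ ≤ r') ∧
      ∀ a : ℂ, a ≠ 0 → r' ≤ Real.log ‖a‖ → Real.log ‖a‖ ≤ r' + 32 →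
        ∃ z, z ≠ 0 ∧ r ≤ Real.log ‖z‖ ∧ Real.log ‖z‖ ≤ r + 32 ∧ f z = a := by
  obtain ⟨C, hC⟩ := exists_abs_log_norm_le_of_omits
  obtain ⟨B, hB, hBe, hBlin, hBdouble⟩ := exists_maxRe_growth (k := fun z => g z - g 0)
    (hg.sub_const _) (by simp) (by
      by_contra! hc
      exact hgc ⟨g 0, fun z => sub_eq_zero.1 (hc z)⟩)
  have hminus : ∀ r : ℝ, ∃ z : ℂ, ‖z‖ = Real.exp r ∧ (g z - g 0).re ≤ 0 := by
    intro r
    obtain ⟨z, hz, hmax⟩ := exists_norm_eq_forall_re_le (hg.const_sub (g 0)) (Real.exp_pos r)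
    have := hmax 0 (by simpa using (Real.exp_pos r).le)
    refine ⟨z, hz, ?_⟩
    simp at this ⊢
    linarith
  obtain ⟨H, hH⟩ : ∃ H : ℝ, ∀ z : ℂ, ‖z‖ ≤ 1 → ‖g 0 + h z‖ ≤ H := by
    obtain ⟨H, hH⟩ := (isCompact_closedBall (0:ℂ) 1).exists_bound_of_continuousOn
      (f := fun z => g 0 + h z) (continuous_const.add hh.continuous).continuousOn
    exact ⟨H, fun z hz => hH z (by simpa using hz)⟩
  have hH0 : 0 ≤ H := (norm_nonneg _).trans (hH 0 (by simp))
  set M : ℝ := |(m:ℝ)| with hM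
  have hM0 : 0 ≤ M := abs_nonneg _
  -- estimates for the size of `f`
  have hfe : ∀ w : ℂ, f (exp w) = exp (m * w + (g (exp w) + h (exp (-w)))) := fun w => by
    rw [hf _ (exp_ne_zero w), Complex.exp_add (m * w), Complex.exp_int_mul, Complex.exp_neg]
  have hlog : ∀ w : ℂ, Real.log ‖f (exp w)‖ =
      m * w.re + (g (exp w) - g 0).re + (g 0 + h (exp (-w))).re := fun w => by
    rw [hfe, Complex.norm_exp, Real.log_exp]; simp; ring
  have hlow : ∀ w : ℂ, 0 ≤ w.re →
      |Real.log ‖f (exp w)‖ - (g (exp w) - g 0).re| ≤ M * w.re + H := fun w hw => by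
    have h1 : |(g 0 + h (exp (-w))).re| ≤ H := (Complex.abs_re_le_norm _).trans
      (hH _ (by rw [Complex.norm_exp]; simpa using hw))
    have h2 : |(m:ℝ) * w.re| = M * w.re := by rw [abs_mul, abs_of_nonneg hw]
    rw [hlog]
    calc _ = |(m:ℝ) * w.re + (g 0 + h (exp (-w))).re| := by congr 1; ring
      _ ≤ _ := (abs_add_le _ _).trans (by rw [h2]; linarith)
  have hloglift : ∀ z : ℂ, z ≠ 0 → exp (log z) = z ∧ (log z).re = Real.log ‖z‖ := fun z hz =>
    ⟨exp_log hz, log_re z⟩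
  have hev : ∀ᶠ r in atTop, ∃ r' ≥ r + 1,
      (∀ z, z ≠ 0 → Real.log ‖z‖ = r → Real.log ‖f z‖ ≤ r') ∧
      ∀ a : ℂ, a ≠ 0 → r' ≤ Real.log ‖a‖ → Real.log ‖a‖ ≤ r' + 32 →
        ∃ z, z ≠ 0 ∧ r ≤ Real.log ‖z‖ ∧ Real.log ‖z‖ ≤ r + 32 ∧ f z = a := by
    filter_upwards [hBlin (18 * M + 2 * H + |C| + 40), hBdouble, eventually_ge_atTop 0]
      with r hr1 hr2 hr0
    have hC0 := abs_nonneg C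
    have hCa := le_abs_self C
    have hMr : 0 ≤ M * r := by positivity
    have hHr : 0 ≤ H * r := by positivity
    have hCr : 0 ≤ |C| * r := by positivity
    refine ⟨B r + M * r + H, by nlinarith, fun z hz hzr => ?_, fun a ha ha1 ha2 => ?_⟩
    · obtain ⟨h1, h2⟩ := hloglift z hz
      have h3 := hlow (log z) (by rw [h2, hzr]; exact hr0)
      rw [h1, h2, hzr] at h3
      have h4 := hB r z (by rw [← hzr, Real.exp_log (norm_pos_iff.2 hz)])
      linarith [(abs_le.1 h3).2]
    · obtain ⟨z1, hz1, hz1B⟩ := hBe (r + 16)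
      obtain ⟨z2, hz2, hz2B⟩ := hminus (r + 16)
      have hz10 : z1 ≠ 0 := norm_pos_iff.1 (by rw [hz1]; exact Real.exp_pos _)
      have hz20 : z2 ≠ 0 := norm_pos_iff.1 (by rw [hz2]; exact Real.exp_pos _)
      obtain ⟨e1, f1⟩ := hloglift z1 hz10
      obtain ⟨e2, f2⟩ := hloglift z2 hz20
      rw [hz1, Real.log_exp] at f1
      rw [hz2, Real.log_exp] at f2
      have l1 := hlow (log z1) (by rw [f1]; linarith)
      have l2 := hlow (log z2) (by rw [f2]; linarith)
      rw [e1, f1, hz1B] at l1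
      rw [e2, f2] at l2
      have g1 : B r + M * r + H + 32 ≤ Real.log ‖f z1‖ := by
        nlinarith [(abs_le.1 l1).1]
      have g2 : Real.log ‖f z2‖ < B r + M * r + H - |C| := by
        nlinarith [(abs_le.1 l2).2]
      have hcont : Continuous fun w => Real.log ‖f (exp w)‖ := by
        simp_rw [hlog]
        have := hg.continuous
        have := hh.continuous
        fun_prop
      obtain ⟨p, hp, hpa⟩ := exists_mem_segment_eq (u := fun w => Real.log ‖f (exp w)‖)
        (x := log z2) (y := log z1) (t := Real.log ‖a‖) hcont.continuousOn
        (by simp only [e2]; linarith) (by simp only [e1]; linarith)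
      have hpre : p.re = r + 16 := by
        obtain ⟨s, t, -, -, hst, rfl⟩ := hp
        simp [f1, f2, ← add_mul, hst]
      have hdist : log z2 ∈ Metric.ball p (16 / 2) := by
        have h1 : ‖log z2 - p‖ ≤ ‖log z2 - log z1‖ := by
          rw [← dist_eq_norm, ← dist_eq_norm]
          have := dist_add_dist_of_mem_segment hp
          linarith [dist_nonneg (x := p) (y := log z1)]
        have h2 : ‖log z2 - log z1‖ ≤ |(log z2 - log z1).re| + |(log z2 - log z1).im| :=
          Complex.norm_le_abs_re_add_abs_im _
        have h3 : |(log z2 - log z1).im| ≤ 2 * Real.pi := by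
          rw [sub_im, abs_le]
          constructor <;> linarith [neg_pi_lt_log_im z1, neg_pi_lt_log_im z2, log_im_le_pi z1,
            log_im_le_pi z2]
        rw [mem_ball_iff_norm]
        have h4 : |(log z2 - log z1).re| = 0 := by simp [f1, f2]
        linarith [Real.pi_lt_d2]
      have ha0 : 0 < ‖a‖ := norm_pos_iff.2 ha
      have hfpos : ∀ w, 0 < ‖f (exp w)‖ := fun w => by
        rw [hfe]; exact norm_pos_iff.2 (exp_ne_zero _)
      by_contra hcon
      push Not at hcon
      have := hC (fun w => f (exp w) / a) p 16 (by norm_num) (by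
          simp_rw [hfe]
          have := hg.comp Complex.differentiable_exp
          have := hh.comp (Complex.differentiable_exp.comp differentiable_neg)
          apply Differentiable.differentiableOn
          simp only [Function.comp_def] at *
          fun_prop) (fun w hw => by
          refine ⟨div_ne_zero (norm_pos_iff.1 (hfpos w)) ha, fun h1 => ?_⟩
          have hw' : |w.re - p.re| < 16 := by
            rw [← sub_re]
            exact (Complex.abs_re_le_norm _).trans_lt (mem_ball_iff_norm.1 hw)
          rw [hpre, abs_lt] at hw'
          have hlw : Real.log ‖exp w‖ = w.re := by rw [Complex.norm_exp, Real.log_exp]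
          refine hcon (exp w) (exp_ne_zero w) (by rw [hlw]; linarith) (by rw [hlw]; linarith) ?_
          rwa [div_eq_one_iff_eq ha] at h1) (by
          rw [norm_div, div_eq_one_iff_eq ha0.ne']
          exact Real.log_injOn_pos (hfpos p) ha0 hpa) _ hdist
      rw [e2, norm_div, Real.log_div (by have := hfpos (log z2); rw [e2] at this; exact this.ne')
        ha0.ne'] at this
      linarith [(abs_le.1 this).1]
  obtain ⟨r₀, hr₀⟩ := eventually_atTop.1 hev
  exact ⟨r₀, hr₀⟩

/-- For `r` large, `f` maps the annulus of thickness `32` starting at level `r` near either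
essential singularity over such an annulus starting at some level `r' > r` near either
essential singularity. -/
def AnnulusCovering (f : ℂ → ℂ) (s s' r r' : ℝ) : Prop :=
  (∀ z, z ≠ 0 → s * Real.log ‖z‖ = r → s' * Real.log ‖f z‖ ≤ r') ∧
    ∀ a : ℂ, a ≠ 0 → r' ≤ s' * Real.log ‖a‖ → s' * Real.log ‖a‖ ≤ r' + 32 →
      ∃ z, z ≠ 0 ∧ r ≤ s * Real.log ‖z‖ ∧ s * Real.log ‖z‖ ≤ r + 32 ∧ f z = a

lemma exists_annulusCovering_infty {f : ℂ → ℂ} (hf : IsTranscendentalSelfMapCStar f) :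
    ∃ r₀ : ℝ, ∀ r ≥ r₀, ∃ r' ≥ r + 1, AnnulusCovering f 1 1 r r' := by
  obtain ⟨m, g, h, hg, hh, hgc, -, hf⟩ := hf
  simpa [AnnulusCovering] using exists_annulus_covering hg hh hgc hf

lemma IsTranscendentalSelfMapCStar.inv {f : ℂ → ℂ} (hf : IsTranscendentalSelfMapCStar f) :
    IsTranscendentalSelfMapCStar fun z => (f z)⁻¹ := by
  obtain ⟨m, g, h, hg, hh, hgc, hhc, hf⟩ := hf
  refine ⟨-m, fun z => -g z, fun z => -h z, hg.neg, hh.neg, fun ⟨c, hc⟩ => hgc ⟨-c, fun z => ?_⟩,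
    fun ⟨c, hc⟩ => hhc ⟨-c, fun z => ?_⟩, fun z hz => ?_⟩
  · rw [← hc z, neg_neg]
  · rw [← hc z, neg_neg]
  · beta_reduce
    rw [hf z hz, mul_inv, ← exp_neg, zpow_neg, neg_add]

lemma IsTranscendentalSelfMapCStar.comp_inv {f : ℂ → ℂ} (hf : IsTranscendentalSelfMapCStar f) :
    IsTranscendentalSelfMapCStar fun z => f z⁻¹ := by
  obtain ⟨m, g, h, hg, hh, hgc, hhc, hf⟩ := hf
  refine ⟨-m, h, g, hh, hg, hhc, hgc, fun z hz => ?_⟩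
  beta_reduce
  rw [hf _ (inv_ne_zero hz), inv_inv, add_comm (h z), inv_zpow']

lemma AnnulusCovering.of_inv {f : ℂ → ℂ} {s s' r r' : ℝ}
    (h : AnnulusCovering (fun z => (f z)⁻¹) s s' r r') : AnnulusCovering f s (-s') r r' := by
  refine ⟨fun z hz hzr => by simpa using h.1 z hz hzr, fun a ha h1 h2 => ?_⟩
  obtain ⟨z, hz, h3, h4, h5⟩ := h.2 a⁻¹ (inv_ne_zero ha) (by simpa using h1) (by simpa using h2)
  exact ⟨z, hz, h3, h4, inv_injective h5⟩

lemma AnnulusCovering.of_comp_inv {f : ℂ → ℂ} {s s' r r' : ℝ}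
    (h : AnnulusCovering (fun z => f z⁻¹) s s' r r') : AnnulusCovering f (-s) s' r r' := by
  refine ⟨fun z hz hzr => ?_, fun a ha h1 h2 => ?_⟩
  · simpa using h.1 z⁻¹ (inv_ne_zero hz) (by simpa using hzr)
  · obtain ⟨z, hz, h3, h4, h5⟩ := h.2 a ha h1 h2
    exact ⟨z⁻¹, inv_ne_zero hz, by simpa using h3, by simpa using h4, h5⟩

lemma exists_annulusCovering {f : ℂ → ℂ} (hf : IsTranscendentalSelfMapCStar f) :
    ∃ r₀ : ℝ, ∀ r ≥ r₀, ∀ s s' : ℝ, (s = 1 ∨ s = -1) → (s' = 1 ∨ s' = -1) →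
      ∃ r' ≥ r + 1, AnnulusCovering f s s' r r' := by
  obtain ⟨a, ha⟩ := exists_annulusCovering_infty hf
  obtain ⟨b, hb⟩ := exists_annulusCovering_infty hf.inv
  obtain ⟨c, hc⟩ := exists_annulusCovering_infty hf.comp_inv
  obtain ⟨d, hd⟩ := exists_annulusCovering_infty hf.comp_inv.inv
  refine ⟨max (max a b) (max c d), fun r hr s s' hs hs' => ?_⟩
  simp only [ge_iff_le, max_le_iff] at hr
  obtain ⟨⟨h1, h2⟩, h3, h4⟩ := hr
  rcases hs with rfl | rfl <;> rcases hs' with rfl | rfl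
  · exact ha r h1
  · obtain ⟨r', h, h'⟩ := hb r h2
    exact ⟨r', h, h'.of_inv⟩
  · obtain ⟨r', h, h'⟩ := hc r h3
    exact ⟨r', h, h'.of_comp_inv⟩
  · obtain ⟨r', h, h'⟩ := hd r h4
    exact ⟨r', h, (AnnulusCovering.of_inv (f := fun z => f z⁻¹) h').of_comp_inv⟩

open MeasureTheory in
/-- Averages of `log ‖F - ζ‖` over values `ζ` on a circle that are omitted by `F` are continuous
and have the mean value property. -/
lemma continuousOn_and_circleAverage_setIntegral_log {U : Set ℂ} {F : ℂ → ℂ} (hU : IsOpen U)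
    (hF : DifferentiableOn ℂ F U) (hFU : IsOpen (F '' U)) {T : ℝ} {S : Set ℝ}
    (hS : MeasurableSet S) (hSf : volume S ≠ ⊤) (hmiss : ∀ θ ∈ S, circleMap 0 T θ ∉ F '' U) :
    ContinuousOn (fun z => ∫ θ in S, Real.log ‖F z - circleMap 0 T θ‖) U ∧
      ∀ c R, 0 < R → Metric.closedBall c R ⊆ U →
        Real.circleAverage (fun z => ∫ θ in S, Real.log ‖F z - circleMap 0 T θ‖) c R =
          ∫ θ in S, Real.log ‖F c - circleMap 0 T θ‖ := by
  have hcm : Continuous (circleMap 0 T) := continuous_circleMap 0 T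
  have : IsFiniteMeasure (volume.restrict S) := ⟨by
    rw [Measure.restrict_apply_univ]; exact hSf.lt_top⟩
  have hbound : ∀ c R, Metric.closedBall c R ⊆ U → ∃ L : ℝ, ∀ z ∈ Metric.closedBall c R,
      ∀ θ ∈ S, ‖Real.log ‖F z - circleMap 0 T θ‖‖ ≤ L := by
    intro c R hcR
    have hK : IsCompact (F '' Metric.closedBall c R) :=
      (isCompact_closedBall c R).image_of_continuousOn (hF.continuousOn.mono hcR)
    obtain ⟨d, hd, hdsub⟩ := hK.exists_thickening_subset_open hFU (image_mono hcR)
    obtain ⟨M, hM⟩ := hK.isBounded.exists_norm_le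
    refine ⟨max |Real.log d| |Real.log (M + |T|)|, fun z hz θ hθ => ?_⟩
    have h1 : d ≤ ‖F z - circleMap 0 T θ‖ := by
      by_contra! hlt
      refine hmiss θ hθ (hdsub ?_)
      rw [Metric.mem_thickening_iff]
      exact ⟨F z, mem_image_of_mem F hz, by rwa [dist_comm, dist_eq_norm]⟩
    have h2 : ‖F z - circleMap 0 T θ‖ ≤ M + |T| :=
      (norm_sub_le _ _).trans (add_le_add (hM _ (mem_image_of_mem F hz)) (by simp))
    rw [Real.norm_eq_abs]
    exact abs_le_max_abs_abs (Real.log_le_log hd h1) (Real.log_le_log (hd.trans_le h1) h2)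
  have hne : ∀ z ∈ U, ∀ θ ∈ S, F z - circleMap 0 T θ ≠ 0 := fun z hz θ hθ h =>
    hmiss θ hθ ⟨z, hz, sub_eq_zero.1 h⟩
  refine ⟨fun z hz => ?_, fun c R hR hcR => ?_⟩
  · obtain ⟨R, hR, hzR⟩ := Metric.nhds_basis_closedBall.mem_iff.1 (hU.mem_nhds hz)
    obtain ⟨L, hL⟩ := hbound z R hzR
    refine ContinuousAt.continuousWithinAt (continuousAt_of_dominated (bound := fun _ => L)
      ?_ ?_ (integrable_const _) ?_)
    · refine Eventually.of_forall fun x => Measurable.aestronglyMeasurable ?_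
      have := hcm.measurable
      fun_prop
    · filter_upwards [Metric.closedBall_mem_nhds z hR] with x hx
      exact (ae_restrict_iff' hS).2 (Eventually.of_forall fun θ hθ => hL x hx θ hθ)
    · refine (ae_restrict_iff' hS).2 (Eventually.of_forall fun θ hθ => ?_)
      have hc : ContinuousAt F z := (hF.continuousOn).continuousAt (hU.mem_nhds hz)
      exact (hc.sub continuousAt_const).norm.log (norm_ne_zero_iff.2 (hne z hz θ hθ))
  · obtain ⟨L, hL⟩ := hbound c R hcR
    have hsph : ∀ t, circleMap c R t ∈ Metric.closedBall c R := fun t =>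
      Metric.sphere_subset_closedBall (circleMap_mem_sphere c hR.le t)
    have hFc : Continuous fun t => F (circleMap c R t) :=
      (hF.continuousOn.mono hcR).comp_continuous (continuous_circleMap c R) hsph
    rw [Real.circleAverage_def, intervalIntegral.integral_of_le Real.two_pi_pos.le,
      integral_integral_swap]
    · rw [← integral_smul]
      refine setIntegral_congr_fun hS fun θ hθ => ?_
      have := AnalyticOnNhd.circleAverage_log_norm_of_ne_zero (c := c) (R := R)
        (g := fun z => F z - circleMap 0 T θ) (by
          rw [abs_of_pos hR]
          exact ((hF.sub_const _).analyticOnNhd hU).mono hcR) (by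
          rw [abs_of_pos hR]
          exact fun u hu => hne u (hcR hu) θ hθ)
      rw [Real.circleAverage_def, intervalIntegral.integral_of_le Real.two_pi_pos.le] at this
      exact this
    · refine Integrable.of_bound (Measurable.aestronglyMeasurable ?_) L ?_
      · have h1 := hcm.measurable
        have h2 := hFc.measurable
        simp only [Function.uncurry_def]
        have h3 : Measurable fun p : ℝ × ℝ => F (circleMap c R p.1) := h2.comp measurable_fst
        have h4 : Measurable fun p : ℝ × ℝ => circleMap 0 T p.2 := h1.comp measurable_snd
        exact Real.measurable_log.comp (h3.sub h4).norm
      · rw [Measure.prod_restrict]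
        refine (ae_restrict_iff' (measurableSet_Ioc.prod hS)).2 (Eventually.of_forall ?_)
        rintro ⟨t, θ⟩ ⟨-, hθ⟩
        exact hL _ (hsph t) θ hθ

/-- The set of angles at which the circle of radius `T` about `0` meets `V`. -/
def circleTrace (V : Set ℂ) (T : ℝ) : Set ℝ := Ioc 0 (2 * Real.pi) ∩ circleMap 0 T ⁻¹' V

lemma measurableSet_circleTrace {V : Set ℂ} (hV : IsOpen V) (T : ℝ) :
    MeasurableSet (circleTrace V T) :=
  measurableSet_Ioc.inter (hV.measurableSet.preimage (continuous_circleMap 0 T).measurable)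

lemma volume_circleTrace_ne_top (V : Set ℂ) (T : ℝ) :
    MeasureTheory.volume (circleTrace V T) ≠ ⊤ :=
  ((MeasureTheory.measure_mono inter_subset_left).trans_lt measure_Ioc_lt_top).ne

/-- The super-mean-value property on an open set. -/
def SuperMeanOn (w : ℂ → ℝ) (U : Set ℂ) : Prop :=
  ∀ c R, 0 < R → Metric.closedBall c R ⊆ U → Real.circleAverage w c R ≤ w c

lemma setIntegral_circle_log_norm_sub {y : ℂ} (hy : y ≠ 0) (l : ℝ) :
    ∫ θ in Ioc 0 (2 * Real.pi), Real.log ‖y - circleMap 0 (Real.exp l) θ‖ =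
      2 * Real.pi * max (Real.log ‖y‖) l := by
  have h := circleAverage_log_norm_sub_const_eq_log_radius_add_posLog (a := y) (c := 0)
    (R := Real.exp l) (Real.exp_pos l).ne'
  rw [Real.circleAverage_def, intervalIntegral.integral_of_le Real.two_pi_pos.le, smul_eq_mul,
    inv_mul_eq_iff_eq_mul₀ Real.two_pi_pos.ne', Real.log_exp, zero_sub, norm_neg,
    Real.posLog_def] at h
  change _ = 2 * Real.pi * (l + max 0 (Real.log _)) at h
  rw [Real.log_mul (inv_pos.2 (Real.exp_pos l)).ne' (norm_ne_zero_iff.2 hy), Real.log_inv,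
    Real.log_exp] at h
  simp_rw [norm_sub_rev y]
  rw [h]
  congr 1
  rw [← max_add_add_left, max_comm]
  congr 1 <;> ring

open MeasureTheory in
/-- A function omitting a disc and a large part of a circle gives rise to a positive function
with the super-mean-value property that is large where the function is small. -/
lemma exists_superMeanOn_of_omits {U : Set ℂ} {F : ℂ → ℂ} (hU : IsOpen U)
    (hF : DifferentiableOn ℂ F U) (hFU : IsOpen (F '' U)) (h0 : ∀ z ∈ U, F z ≠ 0)
    {b : ℂ} {r β l : ℝ} (hr : 0 < r) (hbβ : ‖b‖ ≤ β) (hb : ∀ z ∈ U, r ≤ ‖F z - b‖) :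
    ∃ w : ℂ → ℝ, ContinuousOn w U ∧ SuperMeanOn w U ∧
      (∀ z ∈ U, max (Real.log ‖F z‖) (l + 1) - max (Real.log ‖F z‖) l ≤ w z) ∧
      ∀ z ∈ U, β ≤ ‖F z‖ → 2 * Real.exp (l + 1) ≤ ‖F z‖ →
        w z ≤ (2 * Real.pi)⁻¹ * volume.real (circleTrace (F '' U) (Real.exp (l + 1))) *
          (Real.log (1 + (β + Real.exp (l + 1) + 1) / r) + Real.log 4) := by
  set T := Real.exp (l + 1) with hT
  have hT0 : 0 < T := Real.exp_pos _
  set E := circleTrace (F '' U) T with hE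
  have hEm : MeasurableSet E := measurableSet_circleTrace hFU T
  have hEf : volume E ≠ ⊤ := volume_circleTrace_ne_top _ T
  set S := Ioc 0 (2 * Real.pi) \ E with hS
  have hSm : MeasurableSet S := measurableSet_Ioc.diff hEm
  have hSf : volume S ≠ ⊤ := ((measure_mono sdiff_subset).trans_lt measure_Ioc_lt_top).ne
  obtain ⟨hAc, hAm⟩ := continuousOn_and_circleAverage_setIntegral_log hU hF hFU hSm hSf
    (T := T) (fun θ hθ h => hθ.2 ⟨hθ.1, h⟩)
  set A : ℂ → ℝ := fun z => ∫ θ in S, Real.log ‖F z - circleMap 0 T θ‖ with hA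
  set C : ℝ := 1 + (β + T + 1) / r with hC
  have hβ : 0 ≤ β := (norm_nonneg b).trans hbβ
  have hC0 : 0 < C := by positivity
  set ε : ℝ := (2 * Real.pi)⁻¹ * volume.real E with hε
  have hpi := Real.two_pi_pos
  have hbpos : ∀ z ∈ U, 0 < ‖F z - b‖ := fun z hz => hr.trans_le (hb z hz)
  have hInt0 : ∀ z, IntegrableOn (fun θ => Real.log ‖F z - circleMap 0 T θ‖)
      (Ioc 0 (2 * Real.pi)) := by
    intro z
    have := circleIntegrable_log_norm_sub_const (a := F z) (c := 0) T
    rw [CircleIntegrable, intervalIntegrable_iff_integrableOn_Ioc_of_le hpi.le] at this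
    simpa only [norm_sub_rev] using this
  have hES : E ⊆ Ioc 0 (2 * Real.pi) := inter_subset_left
  have hsplit : ∀ z ∈ U, A z + ∫ θ in E, Real.log ‖F z - circleMap 0 T θ‖ =
      2 * Real.pi * max (Real.log ‖F z‖) (l + 1) := fun z hz => by
    rw [← setIntegral_circle_log_norm_sub (h0 z hz), ← setIntegral_union disjoint_sdiff_left hEm
      ((hInt0 z).mono_set sdiff_subset) ((hInt0 z).mono_set hES), sdiff_union_of_subset hES]
  have hconst : ∀ k : ℝ, ∫ _ in E, k = volume.real E * k := fun k => by
    rw [setIntegral_const, smul_eq_mul]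
  have hconstInt : ∀ k : ℝ, IntegrableOn (fun _ => k) E := fun k => integrableOn_const hEf
  set w : ℂ → ℝ := fun z => (2 * Real.pi)⁻¹ * A z + ε * (Real.log C + Real.log ‖F z - b‖) -
    max (Real.log ‖F z‖) l with hw
  have hwe : ∀ z ∈ U, w z = (max (Real.log ‖F z‖) (l + 1) - max (Real.log ‖F z‖) l) +
      (2 * Real.pi)⁻¹ * (volume.real E * (Real.log C + Real.log ‖F z - b‖) -
        ∫ θ in E, Real.log ‖F z - circleMap 0 T θ‖) := fun z hz => by
    have h1 : max (Real.log ‖F z‖) (l + 1) = (2 * Real.pi)⁻¹ *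
        (A z + ∫ θ in E, Real.log ‖F z - circleMap 0 T θ‖) := by
      rw [hsplit z hz]; field_simp
    rw [h1, hw, hε]; ring
  have hlogb : ContinuousOn (fun z => Real.log ‖F z - b‖) U :=
    (hF.continuousOn.sub continuousOn_const).norm.log fun z hz => (hbpos z hz).ne'
  have hlogF : ContinuousOn (fun z => Real.log ‖F z‖) U :=
    hF.continuousOn.norm.log fun z hz => norm_ne_zero_iff.2 (h0 z hz)
  have hlogm : ContinuousOn (fun z => max (Real.log ‖F z‖) l) U :=
    ContinuousOn.sup hlogF continuousOn_const
  have hAc' : ContinuousOn (fun z => (2 * Real.pi)⁻¹ * A z) U := continuousOn_const.mul hAc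
  have hlogb' : ContinuousOn (fun z => ε * (Real.log C + Real.log ‖F z - b‖)) U :=
    continuousOn_const.mul (continuousOn_const.add hlogb)
  refine ⟨w, (hAc'.add hlogb').sub hlogm, fun c R hR hcR => ?_, fun z hz => ?_,
    fun z hz h1 h2 => ?_⟩
  · have hsub : Metric.sphere c R ⊆ U := Metric.sphere_subset_closedBall.trans hcR
    have hcU : c ∈ U := hcR (Metric.mem_closedBall_self hR.le)
    have ci : ∀ {u : ℂ → ℝ}, ContinuousOn u U → CircleIntegrable u c R := fun hu =>
      (hu.mono hsub).circleIntegrable hR.le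
    have mean : ∀ a : ℂ, (∀ z ∈ U, F z - a ≠ 0) →
        Real.circleAverage (fun z => Real.log ‖F z - a‖) c R = Real.log ‖F c - a‖ := fun a ha => by
      refine AnalyticOnNhd.circleAverage_log_norm_of_ne_zero (g := fun z => F z - a) ?_ ?_
      · rw [abs_of_pos hR]
        exact ((hF.sub_const _).analyticOnNhd hU).mono hcR
      · rw [abs_of_pos hR]
        exact fun u hu => ha u (hcR hu)
    have e1 : Real.circleAverage (fun z => (2 * Real.pi)⁻¹ * A z) c R = (2 * Real.pi)⁻¹ * A c := by
      have := Real.circleAverage_fun_smul (a := (2 * Real.pi)⁻¹) (f := A) (c := c) (R := R)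
      simp only [smul_eq_mul] at this
      rw [this, hAm c R hR hcR]
    have e2 : Real.circleAverage (fun z => ε * (Real.log C + Real.log ‖F z - b‖)) c R =
        ε * (Real.log C + Real.log ‖F c - b‖) := by
      have := Real.circleAverage_fun_smul (a := ε)
        (f := fun z => Real.log C + Real.log ‖F z - b‖) (c := c) (R := R)
      simp only [smul_eq_mul] at this
      rw [this, Real.circleAverage_fun_add (ci continuousOn_const) (ci hlogb),
        Real.circleAverage_const, mean b fun z hz => norm_ne_zero_iff.1 (hbpos z hz).ne']
    have e3 : max (Real.log ‖F c‖) l ≤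
        Real.circleAverage (fun z => max (Real.log ‖F z‖) l) c R := by
      refine max_le ?_ ?_
      · have := mean 0 (by simpa using h0)
        simp only [sub_zero] at this
        rw [← this]
        exact Real.circleAverage_mono (ci hlogF) (ci hlogm) fun x _ => le_max_left _ _
      · have := Real.circleAverage_const l c R
        refine this.symm.le.trans (Real.circleAverage_mono (ci continuousOn_const) (ci hlogm)
          fun x _ => le_max_right _ _)
    have hsum := ci (hAc'.add hlogb')
    simp only [Pi.add_def] at hsum
    rw [hw, Real.circleAverage_fun_sub hsum (ci hlogm),
      Real.circleAverage_fun_add (ci hAc') (ci hlogb'), e1, e2]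
    linarith
  · rw [hwe z hz, le_add_iff_nonneg_right]
    refine mul_nonneg (by positivity) (sub_nonneg.2 ?_)
    rw [← hconst]
    refine setIntegral_mono_on ((hInt0 z).mono_set hES) (hconstInt _) hEm fun θ _ => ?_
    rw [← Real.log_mul hC0.ne' (hbpos z hz).ne']
    have h3 : ‖F z - b‖ + (β + T + 1) ≤ C * ‖F z - b‖ := by
      have h4 : (β + T + 1) / r * r ≤ (β + T + 1) / r * ‖F z - b‖ :=
        mul_le_mul_of_nonneg_left (hb z hz) (by positivity)
      rw [div_mul_cancel₀ _ hr.ne'] at h4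
      rw [hC]; linarith
    have h5 : ‖F z - circleMap 0 T θ‖ ≤ ‖F z - b‖ + (β + T) := by
      calc _ = ‖(F z - b) + (b - circleMap 0 T θ)‖ := by congr 1; ring
        _ ≤ _ := (norm_add_le _ _).trans (add_le_add le_rfl ((norm_sub_le _ _).trans
          (add_le_add hbβ (by simp [abs_of_pos hT0]))))
    rcases eq_or_ne (F z - circleMap 0 T θ) 0 with h6 | h6
    · rw [h6, norm_zero, Real.log_zero]
      exact Real.log_nonneg (by linarith [hbpos z hz])
    · exact Real.log_le_log (norm_pos_iff.2 h6) (by linarith)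
  · have hF0 : 0 < ‖F z‖ := norm_pos_iff.2 (h0 z hz)
    have h3 : l + 1 ≤ Real.log ‖F z‖ := by
      rw [Real.le_log_iff_exp_le hF0]; linarith
    rw [hwe z hz, max_eq_left h3, max_eq_left (by linarith), sub_self, zero_add, hε, mul_assoc]
    refine mul_le_mul_of_nonneg_left ?_ (by positivity)
    have h4 : volume.real E * (Real.log ‖F z‖ - Real.log 2) ≤
        ∫ θ in E, Real.log ‖F z - circleMap 0 T θ‖ := by
      rw [← hconst]
      refine setIntegral_mono_on (hconstInt _) ((hInt0 z).mono_set hES) hEm fun θ _ => ?_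
      rw [← Real.log_div hF0.ne' two_ne_zero]
      refine Real.log_le_log (by positivity) ?_
      have := norm_sub_norm_le (F z) (circleMap 0 T θ)
      have h7 : ‖circleMap 0 T θ‖ = T := by simp [abs_of_pos hT0]
      rw [h7] at this
      linarith
    have h5 : Real.log ‖F z - b‖ ≤ Real.log ‖F z‖ + Real.log 2 := by
      rw [← Real.log_mul hF0.ne' two_ne_zero]
      refine Real.log_le_log (hbpos z hz) ((norm_sub_le _ _).trans ?_)
      linarith
    have h6 : Real.log 4 = Real.log 2 + Real.log 2 := by
      rw [← Real.log_mul two_ne_zero two_ne_zero]; norm_num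
    have h8 : 0 ≤ volume.real E := measureReal_nonneg
    rw [h6]
    nlinarith [mul_le_mul_of_nonneg_left h5 h8]

/-- Minimum principle for continuous functions with the super-mean-value property. -/
lemma SuperMeanOn.le_of_frontier {U : Set ℂ} {w : ℂ → ℝ} (hU : IsOpen U)
    (hUb : Bornology.IsBounded U) (hwc : ContinuousOn w U) (hw : SuperMeanOn w U) {a : ℝ}
    (hfr : ∀ ζ ∈ frontier U, ∀ δ > 0, ∀ᶠ z in 𝓝[U] ζ, a - δ ≤ w z) {z₀ : ℂ} (hz₀ : z₀ ∈ U) :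
    a ≤ w z₀ := by
  by_contra! hlt
  set K : Set ℂ := {z ∈ U | w z ≤ w z₀} with hK
  have hKU : K ⊆ U := fun z hz => hz.1
  have hKclosed : IsClosed K := by
    refine isClosed_of_closure_subset fun ζ hζ => ?_
    have hfreq : ∃ᶠ z in 𝓝 ζ, z ∈ K := mem_closure_iff_frequently.1 hζ
    by_cases hζU : ζ ∈ U
    · refine ⟨hζU, ?_⟩
      by_contra! h
      have := (hwc.continuousAt (hU.mem_nhds hζU)).eventually_const_lt h
      obtain ⟨z, hz1, hz2⟩ := (hfreq.and_eventually this).exists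
      exact hz2.not_ge hz1.2
    · have hζf : ζ ∈ frontier U := by
        rw [hU.frontier_eq]
        exact ⟨closure_mono hKU hζ, hζU⟩
      have := hfr ζ hζf ((a - w z₀) / 2) (by linarith)
      rw [eventually_nhdsWithin_iff] at this
      obtain ⟨z, hz1, hz2⟩ := (hfreq.and_eventually this).exists
      linarith [hz2 hz1.1, hz1.2]
  have hKc : IsCompact K := Metric.isCompact_of_isClosed_isBounded hKclosed (hUb.subset hKU)
  obtain ⟨x, hxK, hx⟩ := hKc.exists_isMinOn ⟨z₀, hz₀, le_rfl⟩ (hwc.mono hKU)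
  have hxmin : ∀ z ∈ U, w x ≤ w z := fun z hz => by
    rcases le_total (w z) (w z₀) with h | h
    · exact hx ⟨hz, h⟩
    · exact hxK.2.trans h
  have hK'c : IsCompact (K ∩ w ⁻¹' {w x}) := by
    refine Metric.isCompact_of_isClosed_isBounded ?_ (hUb.subset (inter_subset_left.trans hKU))
    exact (hwc.mono hKU).preimage_isClosed_of_isClosed hKclosed isClosed_singleton
  obtain ⟨y, ⟨hyK, hyx⟩, hy⟩ := hK'c.exists_isMaxOn ⟨x, hxK, rfl⟩ Complex.continuous_re.continuousOn
  obtain ⟨R, hR, hyR⟩ := Metric.nhds_basis_closedBall.mem_iff.1 (hU.mem_nhds (hKU hyK))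
  have hyx' : w y = w x := hyx
  have hsph : ∀ t, circleMap y R t ∈ U := fun t =>
    hyR (Metric.sphere_subset_closedBall (circleMap_mem_sphere y hR.le t))
  have hcont : Continuous fun t => w (circleMap y R t) :=
    hwc.comp_continuous (continuous_circleMap y R) hsph
  have h1 : ∫ _ in (0:ℝ)..2 * Real.pi, w x < ∫ t in (0:ℝ)..2 * Real.pi, w (circleMap y R t) := by
    refine intervalIntegral.integral_lt_integral_of_continuousOn_of_le_of_exists_lt
      Real.two_pi_pos continuousOn_const hcont.continuousOn (fun t _ => hxmin _ (hsph t))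
      ⟨0, ⟨le_rfl, Real.two_pi_pos.le⟩, ?_⟩
    refine lt_of_le_of_ne (hxmin _ (hsph 0)) fun h => ?_
    have : circleMap y R 0 ∈ K ∩ w ⁻¹' {w x} := ⟨⟨hsph 0, h ▸ hxK.2⟩, h.symm⟩
    have := hy this
    simp [circleMap] at this
    linarith
  have h2 := hw y R hR hyR
  rw [Real.circleAverage_def, smul_eq_mul, inv_mul_le_iff₀ Real.two_pi_pos, hyx'] at h2
  rw [intervalIntegral.integral_const, smul_eq_mul, sub_zero] at h1
  linarith

lemma superMeanOn_sum {ι : Type*} {U : Set ℂ} (s : Finset ι) {w : ι → ℂ → ℝ}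
    (hwc : ∀ i ∈ s, ContinuousOn (w i) U) (hw : ∀ i ∈ s, SuperMeanOn (w i) U) :
    SuperMeanOn (fun z => ∑ i ∈ s, w i z) U := fun c R hR hcR => by
  rw [Real.circleAverage_fun_sum fun i hi =>
    ((hwc i hi).mono (Metric.sphere_subset_closedBall.trans hcR)).circleIntegrable hR.le]
  exact Finset.sum_le_sum fun i hi => hw i hi c R hR hcR

open MeasureTheory in
/-- If holomorphic functions `F n` omit discs and most of each circle, in a summable sense, and
tend to infinity at a point of a bounded open set, then they do so at some boundary point. -/
lemma exists_mem_frontier_tendsto_norm_atTop {U : Set ℂ} (hU : IsOpen U)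
    (hUb : Bornology.IsBounded U) {z₀ : ℂ} (hz₀ : z₀ ∈ U) {F : ℕ → ℂ → ℂ}
    (hFc : ∀ n, ContinuousOn (F n) (closure U)) (hFd : ∀ n, DifferentiableOn ℂ (F n) U)
    (hF0 : ∀ n, ∀ z ∈ closure U, F n z ≠ 0) (hFo : ∀ n, IsOpen (F n '' U)) {b : ℕ → ℂ}
    {r β : ℝ} (hr : 0 < r) (hbβ : ∀ n, ‖b n‖ ≤ β) (hb : ∀ n, ∀ z ∈ U, r ≤ ‖F n z - b n‖)
    (hlim : Tendsto (fun n => ‖F n z₀‖) atTop atTop)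
    (hsum : ∀ T > 0, Summable fun n => volume.real (circleTrace (F n '' U) T)) :
    ∃ ζ ∈ frontier U, Tendsto (fun n => ‖F n ζ‖) atTop atTop := by
  choose w hwc hwm hwφ hwz using fun (k n : ℕ) =>
    exists_superMeanOn_of_omits (l := k) hU (hFd n) (hFo n)
      (fun z hz => hF0 n z (subset_closure hz)) hr (hbβ n) (hb n)
  have hN : ∀ k : ℕ, ∃ N : ℕ, (∀ n ≥ N, β ≤ ‖F n z₀‖ ∧ 2 * Real.exp (k + 1) ≤ ‖F n z₀‖) ∧
      ∀ M, ∑ i ∈ Finset.range M, w k (N + i) z₀ ≤ (1 / 2) ^ (k + 2) := by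
    intro k
    set D := Real.log (1 + (β + Real.exp (k + 1) + 1) / r) + Real.log 4
    have hs := ((hsum (Real.exp (k + 1)) (Real.exp_pos _)).mul_left ((2 * Real.pi)⁻¹)).mul_right D
    obtain ⟨s, hs⟩ := summable_iff_vanishing_norm.1 hs ((1 / 2) ^ (k + 2)) (by positivity)
    obtain ⟨N₁, hN₁⟩ := eventually_atTop.1 ((hlim.eventually_ge_atTop β).and
      (hlim.eventually_ge_atTop (2 * Real.exp (k + 1))))
    obtain ⟨N₂, hN₂⟩ := s.exists_nat_subset_range
    refine ⟨max N₁ N₂, fun n hn => hN₁ n ((le_max_left _ _).trans hn), fun M => ?_⟩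
    have h1 := hs ((Finset.range M).map (addLeftEmbedding (max N₁ N₂))) (by
      rw [Finset.disjoint_left]
      intro a ha has
      have h2 := Finset.mem_range.1 (hN₂ has)
      obtain ⟨i, -, rfl⟩ := Finset.mem_map.1 ha
      simp at h2
      omega)
    rw [Finset.sum_map] at h1
    refine (Finset.sum_le_sum fun i _ => ?_).trans ((le_abs_self _).trans h1.le)
    have h3 := hN₁ (max N₁ N₂ + i) ((le_max_left _ _).trans (Nat.le_add_right _ _))
    exact hwz k _ z₀ hz₀ h3.1 h3.2
  choose N hN hNsum using hN
  have hlogc : ∀ n, ContinuousOn (fun z => Real.log ‖F n z‖) (closure U) := fun n =>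
    (hFc n).norm.log fun z hz => norm_ne_zero_iff.2 (hF0 n z hz)
  let φ : ℕ → ℕ → ℂ → ℝ := fun k n z =>
    max (Real.log ‖F n z‖) (k + 1) - max (Real.log ‖F n z‖) k
  have hφc : ∀ k n, ContinuousOn (φ k n) (closure U) := fun k n =>
    (ContinuousOn.sup (hlogc n) continuousOn_const).sub
      (ContinuousOn.sup (hlogc n) continuousOn_const)
  have hφ0 : ∀ k n z, 0 ≤ φ k n z := fun k n z =>
    sub_nonneg.2 (max_le_max le_rfl (by linarith))
  let C : ℕ → Set ℂ := fun M =>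
    {ζ ∈ frontier U | ∀ k < M, ∀ i < M, Real.exp k ≤ ‖F (N k + i) ζ‖}
  have hfr : frontier U ⊆ closure U := frontier_subset_closure
  have hfc : IsCompact (frontier U) :=
    Metric.isCompact_of_isClosed_isBounded isClosed_frontier (hUb.closure.subset hfr)
  have hCclosed : ∀ M, IsClosed (C M) := by
    intro M
    have : C M = frontier U ∩ ⋂ k < M, ⋂ i < M,
        (frontier U ∩ (fun ζ => ‖F (N k + i) ζ‖) ⁻¹' Ici (Real.exp k)) := by
      ext ζ
      simp only [C, mem_ofPred_eq, mem_inter_iff, mem_iInter, mem_preimage, mem_Ici]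
      exact ⟨fun h => ⟨h.1, fun k hk i hi => ⟨h.1, h.2 k hk i hi⟩⟩,
        fun h => ⟨h.1, fun k hk i hi => (h.2 k hk i hi).2⟩⟩
    rw [this]
    refine isClosed_frontier.inter (isClosed_biInter fun k _ => isClosed_biInter fun i _ => ?_)
    exact (((hFc (N k + i)).mono hfr).norm).preimage_isClosed_of_isClosed isClosed_frontier
      isClosed_Ici
  have hCne : ∀ M, (C M).Nonempty := by
    intro M
    by_contra! hempty
    set s := Finset.range M ×ˢ Finset.range M with hs
    have hlow : ∀ ζ ∈ frontier U, ∀ δ > 0, ∀ᶠ z in 𝓝[U] ζ,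
        1 - δ ≤ ∑ p ∈ s, w p.1 (N p.1 + p.2) z := by
      intro ζ hζ δ hδ
      have h1 : 1 ≤ ∑ p ∈ s, φ p.1 (N p.1 + p.2) ζ := by
        have : ∃ k < M, ∃ i < M, ‖F (N k + i) ζ‖ < Real.exp k := by
          by_contra! h
          exact (hempty ▸ (show ζ ∈ C M from ⟨hζ, h⟩) : ζ ∈ (∅ : Set ℂ))
        obtain ⟨k, hk, i, hi, hlt⟩ := this
        have h2 : φ k (N k + i) ζ = 1 := by
          have hlog : Real.log ‖F (N k + i) ζ‖ ≤ k := by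
            rw [Real.log_le_iff_le_exp (norm_pos_iff.2 (hF0 _ _ (hfr hζ)))]
            exact hlt.le
          simp only [φ]
          rw [max_eq_right hlog, max_eq_right (by linarith)]
          ring
        rw [← h2]
        exact Finset.single_le_sum (f := fun p : ℕ × ℕ => φ p.1 (N p.1 + p.2) ζ)
          (fun p _ => hφ0 _ _ _) (a := (k, i)) (by simp [hs, hk, hi])
      have hc : ContinuousOn (fun z => ∑ p ∈ s, φ p.1 (N p.1 + p.2) z) (closure U) :=
        continuousOn_finsetSum _ fun p _ => hφc _ _
      have h3 := (hc ζ (hfr hζ)).mono subset_closure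
      have h4 := h3.eventually_const_lt (show 1 - δ < _ by linarith)
      filter_upwards [h4, self_mem_nhdsWithin] with z hz hzU
      exact hz.le.trans (Finset.sum_le_sum fun p _ => hwφ _ _ z hzU)
    have h5 := SuperMeanOn.le_of_frontier hU hUb
      (continuousOn_finsetSum s fun p _ => hwc p.1 (N p.1 + p.2))
      (superMeanOn_sum s (fun p _ => hwc _ _) fun p _ => hwm _ _) hlow hz₀
    rw [hs, Finset.sum_product] at h5
    have h6 : ∀ M : ℕ, ∑ k ∈ Finset.range M, (1 / 2 : ℝ) ^ (k + 2) = 1 / 2 - (1 / 2) ^ (M + 1) := by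
      intro M
      induction M with
      | zero => norm_num
      | succ M ih => rw [Finset.sum_range_succ, ih]; ring
    have h7 := (Finset.sum_le_sum fun k (_ : k ∈ Finset.range M) => hNsum k M).trans (h6 M).le
    have h8 : (0:ℝ) < (1 / 2) ^ (M + 1) := by positivity
    linarith
  obtain ⟨ζ, hζ⟩ := IsCompact.nonempty_iInter_of_sequence_nonempty_isCompact_isClosed C
    (fun M ζ hζ => ⟨hζ.1, fun k hk i hi => hζ.2 k (by omega) i (by omega)⟩) hCne
    (hfc.of_isClosed_subset (hCclosed 0) fun ζ hζ => hζ.1) hCclosed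
  rw [mem_iInter] at hζ
  refine ⟨ζ, (hζ 0).1, ?_⟩
  have hk : Tendsto (fun k : ℕ => Real.exp k) atTop atTop :=
    Real.tendsto_exp_atTop.comp tendsto_natCast_atTop_atTop
  refine tendsto_atTop.2 fun T => ?_
  obtain ⟨k, hk⟩ := (hk.eventually_ge_atTop T).exists
  filter_upwards [eventually_ge_atTop (N k)] with n hn
  obtain ⟨i, rfl⟩ := Nat.exists_eq_add_of_le hn
  exact hk.trans ((hζ (k + i + 1)).2 k (by omega) i (by omega))

lemma IsTranscendentalSelfMapCStar.ne_zero {f : ℂ → ℂ} (hf : IsTranscendentalSelfMapCStar f)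
    {z : ℂ} (hz : z ≠ 0) : f z ≠ 0 := by
  obtain ⟨m, g, h, -, -, -, -, hf⟩ := hf
  rw [hf z hz]
  exact mul_ne_zero (zpow_ne_zero _ hz) (exp_ne_zero _)

lemma IsTranscendentalSelfMapCStar.differentiableOn {f : ℂ → ℂ}
    (hf : IsTranscendentalSelfMapCStar f) : DifferentiableOn ℂ f {0}ᶜ := by
  obtain ⟨m, g, h, hg, hh, -, -, hf⟩ := hf
  refine DifferentiableOn.congr (fun z hz => ?_) fun z hz => hf z hz
  have hz' : z ≠ 0 := hz
  have h1 : DifferentiableAt ℂ (fun z => h z⁻¹) z := (hh _).comp z (differentiableAt_inv hz')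
  exact ((differentiableAt_zpow.2 (Or.inl hz')).mul
    ((hg z).add h1).cexp).differentiableWithinAt

lemma IsTranscendentalSelfMapCStar.iterate_ne_zero {f : ℂ → ℂ}
    (hf : IsTranscendentalSelfMapCStar f) (n : ℕ) {z : ℂ} (hz : z ≠ 0) : f^[n] z ≠ 0 := by
  have h : MapsTo f {0}ᶜ {0}ᶜ := fun z hz => hf.ne_zero hz
  exact h.iterate n hz

lemma IsTranscendentalSelfMapCStar.differentiableOn_iterate {f : ℂ → ℂ}
    (hf : IsTranscendentalSelfMapCStar f) (n : ℕ) : DifferentiableOn ℂ f^[n] {0}ᶜ :=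
  hf.differentiableOn.iterate (fun _ hz => hf.ne_zero hz) n

lemma IsTranscendentalSelfMapCStar.isOpen_image {f : ℂ → ℂ}
    (hf : IsTranscendentalSelfMapCStar f) {V : Set ℂ} (hV : IsOpen V) (hV0 : V ⊆ {0}ᶜ) :
    IsOpen (f '' V) := by
  have hpre : IsPreconnected ({0}ᶜ : Set ℂ) :=
    (isConnected_compl_singleton_of_one_lt_rank (by simp) 0).isPreconnected
  rcases (hf.differentiableOn.analyticOnNhd isOpen_compl_singleton).is_constant_or_isOpen hpre
    with ⟨w, hw⟩ | h
  · obtain ⟨r₀, hr₀⟩ := exists_annulusCovering_infty hf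
    obtain ⟨r', -, -, h⟩ := hr₀ r₀ le_rfl
    have key : ∀ t : ℝ, 0 ≤ t → t ≤ 32 → ((Real.exp (r' + t) : ℝ) : ℂ) = w := fun t h0 h1 => by
      have hl : Real.log ‖((Real.exp (r' + t) : ℝ) : ℂ)‖ = r' + t := by
        rw [norm_real, Real.norm_eq_abs, Real.abs_exp, Real.log_exp]
      obtain ⟨z, hz, -, -, hfz⟩ := h (Real.exp (r' + t) : ℝ)
        (ofReal_ne_zero.2 (Real.exp_ne_zero _)) (by rw [hl]; linarith) (by rw [hl]; linarith)
      rw [← hfz, hw z hz]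
    have := (key 0 le_rfl (by norm_num)).trans (key 1 zero_le_one (by norm_num)).symm
    have := Real.exp_injective (ofReal_injective this)
    linarith
  · exact h V hV0 hV

lemma IsTranscendentalSelfMapCStar.isOpen_iterate_image {f : ℂ → ℂ}
    (hf : IsTranscendentalSelfMapCStar f) (n : ℕ) {V : Set ℂ} (hV : IsOpen V)
    (hV0 : V ⊆ {0}ᶜ) : IsOpen (f^[n] '' V) := by
  induction n with
  | zero => simpa using hV
  | succ n ih =>
    rw [iterate_succ', image_comp]
    refine hf.isOpen_image ih ?_
    rintro _ ⟨z, hz, rfl⟩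
    exact hf.iterate_ne_zero n (hV0 hz)

/-- The signed logarithmic size of the `n`-th iterate of `z`. -/
def level (f : ℂ → ℂ) (s : ℕ → ℝ) (n : ℕ) (z : ℂ) : ℝ := s n * Real.log ‖f^[n] z‖

lemma IsTranscendentalSelfMapCStar.continuousOn_level {f : ℂ → ℂ}
    (hf : IsTranscendentalSelfMapCStar f) (s : ℕ → ℝ) (n : ℕ) :
    ContinuousOn (level f s n) {0}ᶜ :=
  continuousOn_const.mul ((hf.differentiableOn_iterate n).continuousOn.norm.log
    fun _ hz => norm_ne_zero_iff.2 (hf.iterate_ne_zero n hz))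

/-- The level function is the logarithm of the modulus of a nonvanishing holomorphic function. -/
lemma IsTranscendentalSelfMapCStar.exists_norm_eq_exp_level {f : ℂ → ℂ}
    (hf : IsTranscendentalSelfMapCStar f) {s : ℕ → ℝ} (hs : ∀ n, s n = 1 ∨ s n = -1) (n : ℕ) :
    ∃ P : ℂ → ℂ, (P = f^[n] ∨ P = fun z => (f^[n] z)⁻¹) ∧ DifferentiableOn ℂ P {0}ᶜ ∧
      ∀ z, z ≠ 0 → P z ≠ 0 ∧ ‖P z‖ = Real.exp (level f s n z) := by
  rcases hs n with h | h
  · refine ⟨f^[n], Or.inl rfl, hf.differentiableOn_iterate n, fun z hz =>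
      ⟨hf.iterate_ne_zero n hz, ?_⟩⟩
    rw [level, h, one_mul, Real.exp_log (norm_pos_iff.2 (hf.iterate_ne_zero n hz))]
  · refine ⟨fun z => (f^[n] z)⁻¹, Or.inr rfl, (hf.differentiableOn_iterate n).inv fun z hz =>
      hf.iterate_ne_zero n hz, fun z hz => ⟨inv_ne_zero (hf.iterate_ne_zero n hz), ?_⟩⟩
    rw [level, h, neg_one_mul, Real.exp_neg,
      Real.exp_log (norm_pos_iff.2 (hf.iterate_ne_zero n hz)), norm_inv]

/-- If iterates are large at one point and small at points nearby, then their images of a disc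
cover a thick annulus. -/
lemma IsTranscendentalSelfMapCStar.exists_annulus_subset_iterate_image {f : ℂ → ℂ}
    (hf : IsTranscendentalSelfMapCStar f) {s : ℕ → ℝ} (hs : ∀ n, s n = 1 ∨ s n = -1)
    {x y : ℂ} {η ρ r : ℝ} (hη0 : Metric.ball x η ⊆ {0}ᶜ)
    (hy : y ∈ Metric.ball x (η / 6)) (hlim : Tendsto (fun n => level f s n y) atTop atTop)
    (hfreq : ∃ᶠ n in atTop, ∃ y' ∈ Metric.ball x (η / 6), level f s n y' ≤ ρ) (hr : ρ ≤ r) :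
    ∃ n, ∀ a : ℂ, a ≠ 0 → r ≤ s n * Real.log ‖a‖ → s n * Real.log ‖a‖ ≤ r + 32 →
      a ∈ f^[n] '' Metric.ball x η := by
  obtain ⟨C, hC⟩ := exists_abs_log_norm_le_of_omits
  obtain ⟨n, ⟨y', hy', hle⟩, hgt⟩ :=
    (hfreq.and_eventually (hlim.eventually_gt_atTop (r + 32 + |C|))).exists
  refine ⟨n, fun a ha h1 h2 => ?_⟩
  have hη : 0 < η := by
    have := Metric.pos_of_mem_ball hy
    linarith
  have hsub6 : Metric.ball x (η / 6) ⊆ Metric.ball x η := Metric.ball_subset_ball (by linarith)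
  have hseg : segment ℝ y' y ⊆ Metric.ball x (η / 6) := (convex_ball x _).segment_subset hy' hy
  obtain ⟨p, hp, hpa⟩ := exists_mem_segment_eq (u := level f s n) (x := y') (y := y)
    (t := s n * Real.log ‖a‖) ((hf.continuousOn_level s n).mono ((hseg.trans hsub6).trans hη0))
    (by linarith) (by linarith [abs_nonneg C])
  have hpb := hseg hp
  have hp0 : p ≠ 0 := hη0 (hsub6 hpb)
  have hy0 : y ≠ 0 := hη0 (hsub6 hy)
  rw [Metric.mem_ball] at hpb hy
  have hbp : Metric.ball p (2 * η / 3) ⊆ Metric.ball x η :=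
    Metric.ball_subset_ball' (by linarith)
  have ha0 : 0 < ‖a‖ := norm_pos_iff.2 ha
  have hs0 : s n ≠ 0 := by rcases hs n with h | h <;> rw [h] <;> norm_num
  by_contra hcon
  have := hC (fun z => f^[n] z / a) p (2 * η / 3) (by linarith)
    (((hf.differentiableOn_iterate n).mono (hbp.trans hη0)).div_const a)
    (fun z hz => ⟨div_ne_zero (hf.iterate_ne_zero n (hη0 (hbp hz))) ha, fun h =>
      hcon ⟨z, hbp hz, (div_eq_one_iff_eq ha).1 h⟩⟩)
    (by
      rw [norm_div, div_eq_one_iff_eq ha0.ne']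
      exact Real.log_injOn_pos (norm_pos_iff.2 (hf.iterate_ne_zero n hp0)) ha0
        (mul_left_cancel₀ hs0 hpa)) y
    (by
      rw [Metric.mem_ball]
      linarith [dist_triangle y x p, dist_comm x p])
  rw [norm_div, Real.log_div (norm_ne_zero_iff.2 (hf.iterate_ne_zero n hy0)) ha0.ne',
    abs_le] at this
  have hCC := le_abs_self C
  rw [level] at hgt
  rcases hs n with h | h <;> rw [h] at hgt h1 h2 <;> linarith

/-- A domain some iterate of which covers a thick annulus at a high level has a boundary point
whose orbit escapes with prescribed signs. -/
lemma IsTranscendentalSelfMapCStar.exists_frontier_tendsto_of_annulus_subset {f : ℂ → ℂ}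
    (hf : IsTranscendentalSelfMapCStar f) :
    ∃ r₀ : ℝ, ∀ (s : ℕ → ℝ) (G : Set ℂ) (N : ℕ) (r : ℝ), (∀ n, s n = 1 ∨ s n = -1) →
      IsOpen G → IsCompact (closure G) → closure G ⊆ {0}ᶜ → r₀ ≤ r →
      (∀ a : ℂ, a ≠ 0 → r ≤ s N * Real.log ‖a‖ → s N * Real.log ‖a‖ ≤ r + 32 →
        a ∈ f^[N] '' G) →
      ∃ ζ ∈ frontier G, Tendsto (fun n => level f s n ζ) atTop atTop := by
  obtain ⟨r₀, hr₀⟩ := exists_annulusCovering hf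
  refine ⟨r₀, fun s G N r hs hG hGc hG0 hr hcov => ?_⟩
  choose! R hR1 hR2 using hr₀
  let ρ : ℕ → ℝ := fun j => Nat.rec r (fun j t => R t (s (N + j)) (s (N + j + 1))) j
  have hρs : ∀ j, ρ (j + 1) = R (ρ j) (s (N + j)) (s (N + j + 1)) := fun j => rfl
  have hρ : ∀ j : ℕ, r + j ≤ ρ j := by
    intro j
    induction j with
    | zero => simp [ρ]
    | succ j ih =>
      have : (0:ℝ) ≤ j := j.cast_nonneg
      have := hR1 (ρ j) (by linarith) (s (N + j)) (s (N + j + 1)) (hs _) (hs _)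
      rw [hρs]; push_cast; linarith
  have hρr : ∀ j, r₀ ≤ ρ j := fun j => by
    have : (0:ℝ) ≤ j := j.cast_nonneg
    linarith [hρ j]
  have hac : ∀ j, AnnulusCovering f (s (N + j)) (s (N + j + 1)) (ρ j) (ρ (j + 1)) := fun j =>
    hR2 _ (hρr j) _ _ (hs _) (hs _)
  have hstep : ∀ j z, z ≠ 0 → level f s (N + j) z = ρ j → level f s (N + j + 1) z ≤ ρ (j + 1) := by
    intro j z hz h
    have := (hac j).1 _ (hf.iterate_ne_zero (N + j) hz) h
    rwa [← iterate_succ_apply' f] at this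
  -- points at the bottom of an annulus stay below the bottoms of the subsequent ones
  have hstay : ∀ z, z ≠ 0 → ∀ m, (∀ j ≤ m, ρ j ≤ level f s (N + j) z) → ∀ j ≤ m,
      level f s (N + j) z = ρ j → level f s (N + m) z = ρ m := by
    intro z hz m hge j hjm hj
    induction m, hjm using Nat.le_induction with
    | base => exact hj
    | succ m hm ih =>
      exact (hstep m z hz (ih fun j hj => hge j (hj.trans m.le_succ))).antisymm
        (hge (m + 1) le_rfl)
  have hpull : ∀ m : ℕ, ∀ a : ℂ, a ≠ 0 → ρ m ≤ s (N + m) * Real.log ‖a‖ →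
      s (N + m) * Real.log ‖a‖ ≤ ρ m + 32 →
      ∃ x ∈ G, f^[N + m] x = a ∧ ∀ j ≤ m, ρ j ≤ level f s (N + j) x := by
    intro m
    induction m with
    | zero =>
      intro a ha h1 h2
      obtain ⟨x, hx, hxa⟩ := hcov a ha h1 h2
      refine ⟨x, hx, hxa, fun j hj => ?_⟩
      obtain rfl := Nat.le_zero.1 hj
      rw [level, add_zero, hxa]
      exact h1
    | succ m ih =>
      intro a ha h1 h2
      obtain ⟨z, hz, h3, h4, h5⟩ := (hac m).2 a ha h1 h2
      obtain ⟨x, hx, hxz, hxj⟩ := ih z hz h3 h4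
      have hxa : f^[N + (m + 1)] x = a := by rw [← add_assoc, iterate_succ_apply', hxz, h5]
      refine ⟨x, hx, hxa, fun j hj => ?_⟩
      rcases hj.lt_or_eq with h | rfl
      · exact hxj j (Nat.lt_succ_iff.1 h)
      · rw [level, hxa]
        exact h1
  let K : ℕ → Set ℂ := fun m => {z ∈ closure G | ∀ j ≤ m, ρ j ≤ level f s (N + j) z}
  have hKclosed : ∀ m, IsClosed (K m) := by
    intro m
    have : K m = closure G ∩ ⋂ j ≤ m, (closure G ∩ level f s (N + j) ⁻¹' Ici (ρ j)) := by
      ext z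
      simp only [K, mem_ofPred_eq, mem_inter_iff, mem_iInter, mem_preimage, mem_Ici]
      exact ⟨fun h => ⟨h.1, fun j hj => ⟨h.1, h.2 j hj⟩⟩, fun h => ⟨h.1, fun j hj => (h.2 j hj).2⟩⟩
    rw [this]
    exact isClosed_closure.inter (isClosed_biInter fun j _ =>
      ((hf.continuousOn_level s _).mono hG0).preimage_isClosed_of_isClosed isClosed_closure
        isClosed_Ici)
  have hne : ∀ m, (K m ∩ frontier G).Nonempty := by
    intro m
    by_contra! hempty
    have hKG : K m ⊆ G := fun z hz => by
      by_contra hzG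
      have : z ∈ K m ∩ frontier G := ⟨hz, by rw [hG.frontier_eq]; exact ⟨hz.1, hzG⟩⟩
      rw [hempty] at this
      exact this
    have hG0' : G ⊆ {0}ᶜ := subset_closure.trans hG0
    -- points of `K m` with strict inequalities are interior
    have hInt0 : ∀ z ∈ K m, (∀ j ≤ m, level f s (N + j) z ≠ ρ j) → z ∈ interior (K m) := by
      intro z hz hj
      rw [mem_interior_iff_mem_nhds]
      have h1 : ∀ᶠ y in 𝓝 z, ∀ j ∈ Finset.range (m + 1), ρ j < level f s (N + j) y := by
        rw [Filter.eventually_all_finset]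
        intro j hjm
        have hjm' : j ≤ m := Nat.lt_succ_iff.1 (Finset.mem_range.1 hjm)
        exact ((hf.continuousOn_level s (N + j)).continuousAt
          (isOpen_compl_singleton.mem_nhds (hG0 hz.1))).eventually_const_lt
          (lt_of_le_of_ne (hz.2 j hjm') (hj j hjm').symm)
      filter_upwards [h1, hG.mem_nhds (hKG hz)] with y hy hyG
      exact ⟨subset_closure hyG, fun j hj => (hy j (Finset.mem_range.2 (Nat.lt_succ_iff.2 hj))).le⟩
    obtain ⟨a, ha, hla⟩ : ∃ a : ℂ, a ≠ 0 ∧ s (N + m) * Real.log ‖a‖ = ρ m + 32 := by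
      refine ⟨(Real.exp (s (N + m) * (ρ m + 32)) : ℝ), ofReal_ne_zero.2 (Real.exp_ne_zero _), ?_⟩
      rw [norm_real, Real.norm_eq_abs, Real.abs_exp, Real.log_exp]
      rcases hs (N + m) with h | h <;> rw [h] <;> ring
    obtain ⟨x, hxG, hxa, hxj⟩ := hpull m a ha (by linarith) (by linarith)
    have hxK : x ∈ K m := ⟨subset_closure hxG, hxj⟩
    have hxl : level f s (N + m) x = ρ m + 32 := by rw [level, hxa, hla]
    have hxint : x ∈ interior (K m) := hInt0 x hxK fun j hj h => by
      have := hstay x (hG0 hxK.1) m hxj j hj h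
      linarith
    obtain ⟨P, -, hPd, hPn⟩ := hf.exists_norm_eq_exp_level hs (N + m)
    have hcl : closure (interior (K m)) ⊆ K m :=
      closure_minimal interior_subset (hKclosed m)
    obtain ⟨z, hz, hmax⟩ := Complex.exists_mem_frontier_isMaxOn_norm (f := P)
      (U := interior (K m)) (hGc.isBounded.subset (interior_subset.trans fun z hz => hz.1))
      ⟨x, hxint⟩ (hPd.mono (hcl.trans (hKG.trans hG0'))).diffContOnCl
    have hzK : z ∈ K m := hcl (frontier_subset_closure hz)
    have hmx : ‖P x‖ ≤ ‖P z‖ := hmax (subset_closure hxint)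
    rw [(hPn x (hG0 hxK.1)).2, (hPn z (hG0 hzK.1)).2, Real.exp_le_exp] at hmx
    rw [isOpen_interior.frontier_eq] at hz
    refine hz.2 (hInt0 z hzK fun j hj h => ?_)
    have := hstay z (hG0 hzK.1) m hzK.2 j hj h
    linarith
  obtain ⟨ζ, hζ⟩ := IsCompact.nonempty_iInter_of_sequence_nonempty_isCompact_isClosed
    (fun m => K m ∩ frontier G)
    (fun m z hz => ⟨⟨hz.1.1, fun j hj => hz.1.2 j (hj.trans m.le_succ)⟩, hz.2⟩) hne
    (hGc.of_isClosed_subset ((hKclosed 0).inter isClosed_frontier) fun z hz => hz.1.1)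
    fun m => (hKclosed m).inter isClosed_frontier
  rw [mem_iInter] at hζ
  refine ⟨ζ, (hζ 0).2, ?_⟩
  rw [← tendsto_add_atTop_iff_nat N]
  refine tendsto_atTop_mono (fun j => ?_)
    (tendsto_atTop_add_const_left atTop r tendsto_natCast_atTop_atTop)
  rw [add_comm j N]
  exact (hρ j).trans ((hζ j).1.2 j le_rfl)

lemma tendsto_level_iterate (f : ℂ → ℂ) (s : ℕ → ℝ) (a : ℕ) (x : ℂ) :
    Tendsto (fun n => level f (fun j => s (j + a)) n (f^[a] x)) atTop atTop ↔
      Tendsto (fun n => level f s n x) atTop atTop := by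
  rw [← tendsto_add_atTop_iff_nat (f := fun n => level f s n x) a]
  simp only [level, iterate_add_apply]

lemma IsTranscendentalSelfMapCStar.closure_iterate_image_subset {f : ℂ → ℂ}
    (hf : IsTranscendentalSelfMapCStar f) {G : Set ℂ} (hGc : IsCompact (closure G))
    (hG0 : closure G ⊆ {0}ᶜ) (n : ℕ) : closure (f^[n] '' G) ⊆ f^[n] '' closure G :=
  closure_minimal (image_mono subset_closure)
    (hGc.image_of_continuousOn ((hf.differentiableOn_iterate n).continuousOn.mono hG0)).isClosed

/-- The iterated images of a domain of escaping points are pairwise disjoint, as long as no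
boundary point escapes in the same way. -/
lemma IsTranscendentalSelfMapCStar.disjoint_iterate_image {f : ℂ → ℂ}
    (hf : IsTranscendentalSelfMapCStar f) {s : ℕ → ℝ} (hs : ∀ n, s n = 1 ∨ s n = -1)
    {G : Set ℂ} (hG : IsOpen G) (hGp : IsPreconnected G) (hGc : IsCompact (closure G))
    (hG0 : closure G ⊆ {0}ᶜ) (hin : ∀ z ∈ G, Tendsto (fun n => level f s n z) atTop atTop)
    (hfr : ∀ z ∈ frontier G, ¬ Tendsto (fun n => level f s n z) atTop atTop)
    {a b : ℕ} (hab : a < b) : Disjoint (f^[a] '' G) (f^[b] '' G) := by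
  rw [disjoint_left]
  intro y hya hyb
  have hG0' : G ⊆ {0}ᶜ := subset_closure.trans hG0
  have hT : ∀ c, ∀ w ∈ f^[c] '' G,
      Tendsto (fun n => level f (fun j => s (j + c)) n w) atTop atTop := by
    rintro c _ ⟨g, hg, rfl⟩
    exact (tendsto_level_iterate f s c g).2 (hin g hg)
  have hss : ∀ᶠ n in atTop, s (n + b) = s (n + a) := by
    filter_upwards [(hT a y hya).eventually_gt_atTop 0, (hT b y hyb).eventually_gt_atTop 0]
      with n h1 h2
    simp only [level] at h1 h2
    rcases hs (n + a) with h | h <;> rcases hs (n + b) with h' | h' <;> rw [h] at h1 <;>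
      rw [h'] at h2 <;> linarith
  have hsub : f^[b] '' G ⊆ f^[a] '' G := by
    refine IsPreconnected.subset_of_closure_inter_subset
      (hGp.image _ ((hf.differentiableOn_iterate b).continuousOn.mono hG0'))
      (hf.isOpen_iterate_image a hG hG0') ⟨y, hyb, hya⟩ ?_
    rintro w ⟨hwa, hwb⟩
    obtain ⟨x, hx, rfl⟩ := hf.closure_iterate_image_subset hGc hG0 a hwa
    have hxt : Tendsto (fun n => level f s n x) atTop atTop := by
      rw [← tendsto_level_iterate f s a]
      refine (hT b _ hwb).congr' ?_
      filter_upwards [hss] with n hn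
      rw [level, level, hn]
    refine ⟨x, ?_, rfl⟩
    by_contra hxG
    exact hfr x (by rw [hG.frontier_eq]; exact ⟨hx, hxG⟩) hxt
  obtain ⟨d, rfl⟩ : ∃ d, b = d + a := ⟨b - a, by omega⟩
  have hd : 0 < d := by omega
  have hmaps : MapsTo f^[d] (f^[a] '' G) (f^[a] '' G) := by
    rintro _ ⟨g, hg, rfl⟩
    rw [← iterate_add_apply]
    exact hsub ⟨g, hg, rfl⟩
  obtain ⟨C, hC⟩ := (hGc.image_of_continuousOn
    ((hf.differentiableOn_iterate a).continuousOn.mono hG0)).exists_bound_of_continuousOn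
    (f := fun w => Real.log ‖w‖) (continuous_norm.continuousOn.log (by
      rintro _ ⟨g, hg, rfl⟩
      exact norm_ne_zero_iff.2 (hf.iterate_ne_zero a (hG0 hg))))
  obtain ⟨g, hg, -⟩ := hya
  have hlim := (hin g hg).comp (tendsto_atTop_mono
    (fun k : ℕ => (Nat.le_mul_of_pos_left k hd).trans (Nat.le_add_right (d * k) a)) tendsto_id)
  obtain ⟨k, hk⟩ := (hlim.eventually_gt_atTop C).exists
  have hmem : f^[d * k + a] g ∈ f^[a] '' G := by
    rw [iterate_add_apply, iterate_mul]
    exact hmaps.iterate k ⟨g, hg, rfl⟩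
  have hb := hC _ (image_mono subset_closure hmem)
  rw [Real.norm_eq_abs, abs_le] at hb
  simp only [comp_apply, level] at hk
  rcases hs (d * k + a) with h | h <;> rw [h] at hk <;> linarith

lemma summable_volume_circleTrace {V : ℕ → Set ℂ} (hV : ∀ n, MeasurableSet (V n))
    (hd : Pairwise (Disjoint on V)) (T : ℝ) :
    Summable fun n => MeasureTheory.volume.real (circleTrace (V n) T) := by
  refine ENNReal.summable_toReal ?_
  rw [← MeasureTheory.measure_iUnion]
  · refine ((MeasureTheory.measure_mono (t := Ioc 0 (2 * Real.pi)) ?_).trans_lt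
      measure_Ioc_lt_top).ne
    exact iUnion_subset fun n => inter_subset_left
  · intro i j hij
    exact ((hd hij).preimage _).mono inter_subset_right inter_subset_right
  · intro n
    exact measurableSet_Ioc.inter ((hV n).preimage (continuous_circleMap 0 T).measurable)

/-- A domain of escaping points has a boundary point escaping in the same way. -/
lemma IsTranscendentalSelfMapCStar.exists_frontier_tendsto_of_forall {f : ℂ → ℂ}
    (hf : IsTranscendentalSelfMapCStar f) {s : ℕ → ℝ} (hs : ∀ n, s n = 1 ∨ s n = -1)
    {G : Set ℂ} (hG : IsOpen G) (hGn : IsConnected G) (hGc : IsCompact (closure G))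
    (hG0 : closure G ⊆ {0}ᶜ) (hin : ∀ z ∈ G, Tendsto (fun n => level f s n z) atTop atTop) :
    ∃ ζ ∈ frontier G, Tendsto (fun n => level f s n ζ) atTop atTop := by
  by_contra! hfr
  have hG0' : G ⊆ {0}ᶜ := subset_closure.trans hG0
  have hdisj : ∀ a b, a < b → Disjoint (f^[a] '' G) (f^[b] '' G) := fun a b hab =>
    hf.disjoint_iterate_image hs hG hGn.isPreconnected hGc hG0 hin hfr hab
  obtain ⟨z₀, hz₀⟩ := hGn.nonempty
  have hz₀0 : z₀ ≠ 0 := hG0' hz₀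
  choose P hP hPd hPn using fun n => hf.exists_norm_eq_exp_level hs n
  have hVopen : ∀ n, IsOpen (f^[n] '' G) := fun n => hf.isOpen_iterate_image n hG hG0'
  have hV0 : ∀ n, f^[n] '' G ⊆ {0}ᶜ := by
    rintro n _ ⟨g, hg, rfl⟩
    exact hf.iterate_ne_zero n (hG0' hg)
  have himg : ∀ n, P n '' G = f^[n] '' G ∨ P n '' G = Inv.inv ⁻¹' (f^[n] '' G) := by
    intro n
    rcases hP n with h | h
    · left; rw [h]
    · right
      rw [h, inv_preimage, ← image_inv_eq_inv, image_image]
  have hopen : ∀ n, IsOpen (P n '' G) := by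
    intro n
    rcases himg n with h | h
    · rw [h]; exact hVopen n
    · rw [h]
      have : Inv.inv ⁻¹' (f^[n] '' G) = {0}ᶜ ∩ Inv.inv ⁻¹' (f^[n] '' G) := by
        refine (inter_eq_right.2 fun z hz => ?_).symm
        exact inv_eq_zero.not.1 (hV0 n hz)
      rw [this]
      exact continuousOn_inv₀.isOpen_inter_preimage isOpen_compl_singleton (hVopen n)
  obtain ⟨r₁, hr₁, hb₁⟩ := Metric.isOpen_iff.1 hG z₀ hz₀
  have hGinv : Inv.inv ⁻¹' G ∈ 𝓝 z₀⁻¹ := by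
    refine (continuousAt_inv₀ (inv_ne_zero hz₀0)).preimage_mem_nhds ?_
    rw [inv_inv]
    exact hG.mem_nhds hz₀
  obtain ⟨r₂, hr₂, hb₂⟩ := Metric.mem_nhds_iff.1 hGinv
  have hnot : ∀ n, ∀ z ∈ G, f^[n + 1] z ∉ G := fun n z hz h =>
    disjoint_left.1 (hdisj 0 (n + 1) n.succ_pos) (by simpa using h) ⟨z, hz, rfl⟩
  have hbex : ∀ n, ∃ b : ℂ, ‖b‖ ≤ max ‖z₀‖ ‖z₀⁻¹‖ ∧
      ∀ z ∈ G, min r₁ r₂ ≤ ‖P (n + 1) z - b‖ := by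
    intro n
    rcases hP (n + 1) with h | h
    · refine ⟨z₀, le_max_left _ _, fun z hz => ?_⟩
      by_contra! hlt
      refine hnot n z hz (hb₁ ?_)
      rw [Metric.mem_ball, dist_eq_norm, ← h]
      exact hlt.trans_le (min_le_left _ _)
    · refine ⟨z₀⁻¹, le_max_right _ _, fun z hz => ?_⟩
      by_contra! hlt
      have hm : P (n + 1) z ∈ Inv.inv ⁻¹' G := hb₂ (by
        rw [Metric.mem_ball, dist_eq_norm]
        exact hlt.trans_le (min_le_right _ _))
      rw [h, mem_preimage, inv_inv] at hm
      exact hnot n z hz hm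
  choose b hbn hbr using hbex
  have hpair : Pairwise (Disjoint on fun n => f^[n + 1] '' G) := by
    refine (pairwise_disjoint_on _).2 fun i j hij => ?_
    exact hdisj _ _ (Nat.succ_lt_succ hij)
  obtain ⟨ζ, hζ, hlim⟩ := exists_mem_frontier_tendsto_norm_atTop hG
    (hGc.isBounded.subset subset_closure) hz₀ (F := fun n => P (n + 1))
    (fun n => (hPd _).continuousOn.mono hG0) (fun n => (hPd _).mono hG0')
    (fun n z hz => (hPn _ z (hG0 hz)).1) (fun n => hopen _) (lt_min hr₁ hr₂) hbn hbr
    (by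
      simp only [(hPn _ z₀ hz₀0).2]
      exact Real.tendsto_exp_atTop.comp ((tendsto_add_atTop_iff_nat 1).2 (hin z₀ hz₀)))
    (by
      intro T _
      refine Summable.of_nonneg_of_le (fun n => MeasureTheory.measureReal_nonneg) (fun n => ?_)
        ((summable_volume_circleTrace (fun n => (hVopen (n + 1)).measurableSet) hpair T).add
        (summable_volume_circleTrace (V := fun n => Inv.inv ⁻¹' (f^[n + 1] '' G))
          (fun n => measurable_inv (hVopen (n + 1)).measurableSet)
          (fun i j hij => (hpair hij).preimage _) T))
      rcases himg (n + 1) with h | h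
      · rw [h]; exact le_add_of_nonneg_right MeasureTheory.measureReal_nonneg
      · rw [h]; exact le_add_of_nonneg_left MeasureTheory.measureReal_nonneg)
  refine hfr ζ hζ ?_
  simp only [(hPn _ ζ (hG0 (frontier_subset_closure hζ))).2] at hlim
  rw [← tendsto_add_atTop_iff_nat 1]
  exact Real.tendsto_exp_comp_atTop.1 hlim

/-- A domain containing a point whose orbit escapes with prescribed signs has such a point on
its boundary. -/
lemma IsTranscendentalSelfMapCStar.exists_frontier_tendsto {f : ℂ → ℂ}
    (hf : IsTranscendentalSelfMapCStar f) {s : ℕ → ℝ} (hs : ∀ n, s n = 1 ∨ s n = -1)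
    {G : Set ℂ} (hG : IsOpen G) (hGp : IsPreconnected G) (hGc : IsCompact (closure G))
    (hG0 : closure G ⊆ {0}ᶜ) {z₀ : ℂ} (hz₀ : z₀ ∈ G)
    (hlim : Tendsto (fun n => level f s n z₀) atTop atTop) :
    ∃ ζ ∈ frontier G, Tendsto (fun n => level f s n ζ) atTop atTop := by
  let I : Set ℂ := {z | Tendsto (fun n => level f s n z) atTop atTop}
  by_cases h : ∀ x ∈ G ∩ closure I, ∃ δ > 0, ∀ y ∈ Metric.ball x δ, y ∈ I
  · refine hf.exists_frontier_tendsto_of_forall hs hG ⟨⟨z₀, hz₀⟩, hGp⟩ hGc hG0 fun z hz => ?_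
    refine interior_subset (s := I) (hGp.subset_left_of_subset_union isOpen_interior
      isClosed_closure.isOpen_compl (v := (closure I)ᶜ) ?_ ?_ ?_ hz)
    · exact disjoint_left.2 fun x hx hx' => hx' (subset_closure (interior_subset hx))
    · intro x hx
      by_cases hxI : x ∈ closure I
      · obtain ⟨δ, hδ, hb⟩ := h x ⟨hx, hxI⟩
        exact Or.inl (mem_interior.2 ⟨_, hb, Metric.isOpen_ball, Metric.mem_ball_self hδ⟩)
      · exact Or.inr hxI
    · obtain ⟨δ, hδ, hb⟩ := h z₀ ⟨hz₀, subset_closure hlim⟩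
      exact ⟨z₀, hz₀, mem_interior.2 ⟨_, hb, Metric.isOpen_ball, Metric.mem_ball_self hδ⟩⟩
  · push Not at h
    obtain ⟨x, ⟨hxG, hxI⟩, hx⟩ := h
    obtain ⟨r₀, hr₀⟩ := hf.exists_frontier_tendsto_of_annulus_subset
    obtain ⟨η, hη, hball⟩ := Metric.isOpen_iff.1 hG x hxG
    obtain ⟨y', hy', hy'I⟩ := hx (η / 6) (by positivity)
    obtain ⟨y, hyI, hy⟩ := Metric.mem_closure_iff.1 hxI (η / 6) (by positivity)
    obtain ⟨ρ, hρ⟩ : ∃ ρ, ∃ᶠ n in atTop, level f s n y' ≤ ρ := by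
      by_contra! hcon
      refine hy'I (tendsto_atTop.2 fun ρ => ?_)
      filter_upwards [hcon ρ] with n hn
      exact hn.le
    obtain ⟨N, hN⟩ := hf.exists_annulus_subset_iterate_image hs
      (hball.trans (subset_closure.trans hG0)) (Metric.mem_ball'.2 hy) hyI
      (hρ.mono fun n hn => ⟨y', hy', hn⟩) (le_max_right r₀ ρ)
    exact hr₀ s G N _ hs hG hGc hG0 (le_max_left _ _) fun a ha h1 h2 =>
      image_mono hball (hN a ha h1 h2)

/-- If `G ⊆ ℂ*` is a domain, bounded in `ℂ*`, meeting `I_e(f)`, then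
`∂G ∩ I_e(f) ≠ ∅` (the boundary `∂G` is taken in `ℂ*`). -/
theorem boundary_meets_littleEscapingSet (f : ℂ → ℂ)
    (hf : IsTranscendentalSelfMapCStar f) (e : ℕ → Bool) (G : Set ℂ)
    (hGopen : IsOpen G) (hGconn : IsConnected G) (hGsub : G ⊆ {z : ℂ | z ≠ 0})
    (hGbdd : BoundedInCStar G) (hGI : (G ∩ littleEscapingSet f e).Nonempty) :
    (boundaryInCStar G ∩ littleEscapingSet f e).Nonempty := by
  obtain ⟨ρ, R, hρ, -, hGR⟩ := hGbdd
  have hcl : closure G ⊆ {z : ℂ | ρ ≤ ‖z‖ ∧ ‖z‖ ≤ R} :=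
    closure_minimal hGR ((isClosed_le continuous_const continuous_norm).inter
      (isClosed_le continuous_norm continuous_const))
  have hGc : IsCompact (closure G) :=
    (isCompact_closedBall (0 : ℂ) R).of_isClosed_subset isClosed_closure fun z hz => by
      simpa using (hcl hz).2
  have hG0 : closure G ⊆ {0}ᶜ := fun z hz => norm_pos_iff.1 (hρ.trans_le (hcl hz).1)
  obtain ⟨z, hzG, ⟨hz0, hzI⟩, ℓ, k, hzk⟩ := hGI
  let s : ℕ → ℝ := fun n => if e (n + k) = true then 1 else -1
  have hs : ∀ n, s n = 1 ∨ s n = -1 := fun n => by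
    by_cases h : e (n + k) = true <;> simp [s, h]
  have hlim : Tendsto (fun n => level f s n (f^[ℓ] z)) atTop atTop := by
    rw [tendsto_atTop]
    intro A
    obtain ⟨N, hN⟩ := hzI (Real.exp (-|A|)) (Real.exp_pos _)
    filter_upwards [eventually_ge_atTop N] with n hn
    have h1 := hN (n + ℓ) (by omega)
    have h2 := hzk n
    have h0 : 0 < ‖f^[n + ℓ] z‖ := norm_pos_iff.2 (hf.iterate_ne_zero _ hz0)
    rw [one_div, ← Real.exp_neg, neg_neg, ← Real.log_lt_iff_lt_exp h0,
      ← Real.lt_log_iff_exp_lt h0] at h1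
    rw [level, ← iterate_add_apply]
    have hA := le_abs_self A
    have hA0 := abs_nonneg A
    by_cases h : e (n + k) = true
    · have := Real.log_pos (h2.2 h)
      simp only [s, h, if_true]
      rcases h1 with h1 | h1 <;> linarith
    · have := Real.log_nonpos h0.le (not_lt.1 fun h' => h (h2.1 h'))
      simp only [s, h]
      rcases h1 with h1 | h1 <;> simp <;> linarith
  have hcont := (hf.differentiableOn_iterate ℓ).continuousOn
  have hsub := hf.closure_iterate_image_subset hGc hG0 ℓ
  have hG'o : IsOpen (f^[ℓ] '' G) := hf.isOpen_iterate_image ℓ hGopen (subset_closure.trans hG0)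
  obtain ⟨_, hζ, hζlim⟩ := hf.exists_frontier_tendsto hs hG'o
    (hGconn.isPreconnected.image _ (hcont.mono (subset_closure.trans hG0)))
    ((hGc.image_of_continuousOn (hcont.mono hG0)).of_isClosed_subset isClosed_closure hsub)
    (hsub.trans (by
      rintro _ ⟨w, hw, rfl⟩
      exact hf.iterate_ne_zero ℓ (hG0 hw)))
    (mem_image_of_mem _ hzG) hlim
  rw [hG'o.frontier_eq] at hζ
  obtain ⟨ζ, hζG, rfl⟩ := hsub hζ.1
  have hζ0 : ζ ≠ 0 := hG0 hζG
  refine ⟨ζ, ⟨?_, hζ0⟩, ⟨hζ0, fun ε hε => ?_⟩, ?_⟩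
  · rw [hGopen.frontier_eq]
    exact ⟨hζG, fun h => hζ.2 ⟨ζ, h, rfl⟩⟩
  · obtain ⟨N, hN⟩ := eventually_atTop.1 (hζlim.eventually_gt_atTop (-Real.log ε))
    refine ⟨N + ℓ, fun n hn => ?_⟩
    obtain ⟨m, rfl⟩ : ∃ m, n = m + ℓ := ⟨n - ℓ, by omega⟩
    have h := hN m (by omega)
    have h0 : 0 < ‖f^[m + ℓ] ζ‖ := norm_pos_iff.2 (hf.iterate_ne_zero _ hζ0)
    rw [level, ← iterate_add_apply] at h
    rcases hs m with hm | hm <;> rw [hm] at h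
    · right
      rw [one_div, ← Real.log_lt_log_iff (inv_pos.2 hε) h0, Real.log_inv]
      linarith
    · left
      rw [← Real.log_lt_log_iff h0 hε]
      linarith
  · obtain ⟨N, hN⟩ := eventually_atTop.1 (hζlim.eventually_gt_atTop 0)
    refine ⟨N + ℓ, N + k, fun n => ?_⟩
    have h := hN (n + N) (by omega)
    have h0 : 0 < ‖f^[n + N + ℓ] ζ‖ := norm_pos_iff.2 (hf.iterate_ne_zero _ hζ0)
    rw [level, ← iterate_add_apply] at h
    rw [← add_assoc, ← add_assoc, ← Real.log_pos_iff h0.le]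
    by_cases he : e (n + N + k) = true
    · simp only [s, he, if_true] at h
      simp only [he, iff_true]
      linarith
    · simp only [s, he] at h
      simp only [he]
      simp at h ⊢
      linarith
end
end

section
/- Let R > 0 satisfy: (i) |exp(ε + z⁻²) − 1| ≤ 4|z|⁻² for all z ∈ ℂ* and ε ∈ ℂ with |ε| ≤ |z|⁻² ≤ 4/R², and (ii) R ≥ 8|z|⁻¹ + 12R|z|⁻² for all z with |z| ≥ R/2. Let S = {z ∈ ℂ : |z − 3R| ≤ R} ∪ {z ∈ ℂ : Re z ≥ 3R}, and let g be an entire function with |g(w) − Log w| < |w|⁻² for all w ∈ S, where Log denotes the principal branch of the logarithm. Define f(z) = exp(g(z + 3R) + z⁻²) for z ∈ ℂ* and S' = {z ∈ ℂ : |z| > R/2 and z + 3R ∈ S}. Then for every z ∈ S' one has Re f(z) ≥ Re z + 2R; in particular f(S') ⊆ S'. -/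
open Complex Topology Filter Set Function OnePoint

noncomputable section

/-- The key estimate in the construction of a doubly connected Baker
domain: with `R`, `S`, `g`, `f` and `S'` as in the construction, every `z ∈ S'` satisfies
`Re f(z) ≥ Re z + 2R`; in particular `f(S') ⊆ S'`. -/
theorem baker_domain_construction_estimate (R : ℝ) (hR : 0 < R)
    (h1 : ∀ z : ℂ, z ≠ 0 → ∀ ε : ℂ, ‖ε‖ ≤ (‖z‖ ^ 2)⁻¹ → (‖z‖ ^ 2)⁻¹ ≤ 4 / R ^ 2 →
      ‖Complex.exp (ε + (z ^ 2)⁻¹) - 1‖ ≤ 4 * (‖z‖ ^ 2)⁻¹)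
    (h2 : ∀ z : ℂ, R / 2 ≤ ‖z‖ → 8 * ‖z‖⁻¹ + 12 * R * (‖z‖ ^ 2)⁻¹ ≤ R)
    (S : Set ℂ)
    (hS : S = {z : ℂ | ‖z - ((3 * R : ℝ) : ℂ)‖ ≤ R} ∪ {z : ℂ | 3 * R ≤ z.re})
    (g : ℂ → ℂ) (hg : Differentiable ℂ g)
    (hgS : ∀ w ∈ S, ‖g w - Complex.log w‖ < (‖w‖ ^ 2)⁻¹)
    (f : ℂ → ℂ)
    (hf : ∀ z : ℂ, f z = Complex.exp (g (z + ((3 * R : ℝ) : ℂ)) + (z ^ 2)⁻¹))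
    (S' : Set ℂ) (hS' : S' = {z : ℂ | R / 2 < ‖z‖ ∧ z + ((3 * R : ℝ) : ℂ) ∈ S}) :
    ∀ z ∈ S', z.re + 2 * R ≤ (f z).re ∧ f z ∈ S' := by
  intro z hz
  subst hS hS'
  obtain ⟨hzR, hw⟩ := hz
  have hzpos : 0 < ‖z‖ := by linarith
  have hz0 : z ≠ 0 := norm_pos_iff.mp hzpos
  set w : ℂ := z + ((3 * R : ℝ) : ℂ) with hwdef
  have hwre : w.re = z.re + 3 * R := by
    rw [hwdef, add_re, ofReal_re]
  have hwz : w - ((3 * R : ℝ) : ℂ) = z := by rw [hwdef]; ring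
  have hcases : ‖z‖ ≤ R ∨ 0 ≤ z.re := by
    rcases hw with h | h
    · left
      rwa [mem_ofPred_eq, hwz] at h
    · right
      rw [mem_ofPred_eq, hwre] at h
      linarith
  have hzre : -R ≤ z.re := by
    rcases hcases with h | h
    · linarith [neg_abs_le z.re, abs_re_le_norm z]
    · linarith
  have hw0 : w ≠ 0 := by
    intro h
    rw [h, zero_re] at hwre
    linarith
  have hnorm : ‖z‖ ≤ ‖w‖ := by
    rcases hcases with h | h
    · linarith [re_le_norm w]
    · have hwim : w.im = z.im := by rw [hwdef, add_im, ofReal_im, add_zero]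
      rw [← sq_le_sq₀ (norm_nonneg _) (norm_nonneg _), ← normSq_eq_norm_sq,
        ← normSq_eq_norm_sq, normSq_apply, normSq_apply, hwre, hwim]
      nlinarith [mul_nonneg h hR.le, sq_nonneg R]
  have hε : ‖g w - Complex.log w‖ ≤ (‖z‖ ^ 2)⁻¹ :=
    (hgS w hw).le.trans (by gcongr)
  have hz2 : (‖z‖ ^ 2)⁻¹ ≤ 4 / R ^ 2 := by
    calc (‖z‖ ^ 2)⁻¹ ≤ ((R / 2) ^ 2)⁻¹ := by gcongr
      _ = 4 / R ^ 2 := by field_simp; norm_num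
  have hexp := h1 z hz0 _ hε hz2
  have hfz : f z - w = w * (Complex.exp (g w - Complex.log w + (z ^ 2)⁻¹) - 1) := by
    have hsplit : g w + (z ^ 2)⁻¹ = Complex.log w + (g w - Complex.log w + (z ^ 2)⁻¹) := by ring
    rw [hf, hsplit, Complex.exp_add, Complex.exp_log hw0]
    ring
  have hwle : ‖w‖ ≤ ‖z‖ + 3 * R := by
    refine (norm_add_le _ _).trans_eq ?_
    rw [norm_real, Real.norm_of_nonneg (by positivity)]
  have hdist : ‖f z - w‖ ≤ R := by
    calc ‖f z - w‖ ≤ (‖z‖ + 3 * R) * (4 * (‖z‖ ^ 2)⁻¹) := by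
          rw [hfz, norm_mul]
          gcongr
      _ = 4 * ‖z‖⁻¹ + 12 * R * (‖z‖ ^ 2)⁻¹ := by field_simp; ring
      _ ≤ R := by linarith [h2 z hzR.le, inv_pos.mpr hzpos]
  have hmain : z.re + 2 * R ≤ (f z).re := by
    have habs := (abs_le.mp ((abs_re_le_norm (f z - w)).trans hdist)).1
    rw [sub_re] at habs
    linarith
  refine ⟨hmain, ?_, Or.inr ?_⟩
  · linarith [re_le_norm (f z)]
  · rw [mem_ofPred_eq, add_re, ofReal_re]
    linarith
end
end
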